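/- arXiv:1412.5842 — 5 statements merged into one kernel-verified Lean document; each statement's English description precedes it below -/
import Mathlib

section
/- Let d ≥ 2, n ≥ 1, and 1 ≤ t ≤ n. If the directed de Bruijn graph B⃗(d,n) has a t-identifying code, then every t-identifying code of B⃗(d,n) has cardinality at least d^{n−1}(d−1). -/
/- Common framework: the directed de Bruijn graph B⃗(d,n).
Vertices are strings of length `n` over the alphabet `A_d = Fin d`,
modelled as functions `Fin n → Fin d` (0-indexed; the paper's 1-indexed
position `i` corresponds to index `i - 1` here). -/

namespace DeBruijnPaper

/-- Vertices of the directed de Bruijn graph: strings of length `n` over `Fin d`. -/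
abbrev Vtx (d n : ℕ) := Fin n → Fin d

/-- Directed edge from `x = x₁⋯xₙ` to `y = y₁⋯yₙ`:
`x₂x₃⋯xₙ = y₁y₂⋯y_{n−1}`. -/
def adj (d n : ℕ) (x y : Vtx d n) : Prop :=
  ∀ (i : ℕ) (h : i + 1 < n), x ⟨i + 1, h⟩ = y ⟨i, by omega⟩

/-- There is a directed walk of length `t` from `x` to `y`. -/
def hasWalk (d n : ℕ) (t : ℕ) (x y : Vtx d n) : Prop :=
  ∃ f : ℕ → Vtx d n, f 0 = x ∧ f t = y ∧ ∀ i < t, adj d n (f i) (f (i + 1))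

/-- Directed distance `d⃗(x,y)`: the length of a shortest directed path
(equivalently walk) from `x` to `y`. -/
noncomputable def dirDist (d n : ℕ) (x y : Vtx d n) : ℕ :=
  sInf {t : ℕ | hasWalk d n t x y}

/-- The in-ball `B_t^−(v) = {u : d⃗(u,v) ≤ t}`. -/
def inBall (d n t : ℕ) (v : Vtx d n) : Set (Vtx d n) :=
  {u : Vtx d n | dirDist d n u v ≤ t}

/-- `S` is a `t`-identifying code: every vertex has a nonempty identifying set
`B_t^−(v) ∩ S`, and distinct vertices have distinct identifying sets. -/
def IsIdCode (d n t : ℕ) (S : Set (Vtx d n)) : Prop :=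
  (∀ v : Vtx d n, (inBall d n t v ∩ S).Nonempty) ∧
    ∀ u v : Vtx d n, u ≠ v → inBall d n t u ∩ S ≠ inBall d n t v ∩ S

/-- `S` is a (directed) `t`-dominating set. -/
def IsDomSet (d n t : ℕ) (S : Set (Vtx d n)) : Prop :=
  ∀ v : Vtx d n, (inBall d n t v ∩ S).Nonempty

/-- `S` is a directed resolving set. -/
def IsResolving (d n : ℕ) (S : Set (Vtx d n)) : Prop :=
  ∀ u v : Vtx d n, u ≠ v → ∃ s ∈ S, dirDist d n s u ≠ dirDist d n s v

/-- The directed metric dimension: minimum size of a directed resolving set. -/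
noncomputable def metricDim (d n : ℕ) : ℕ :=
  sInf {k : ℕ | ∃ S : Set (Vtx d n), IsResolving d n S ∧ S.ncard = k}

/-- `π` is an automorphism of the directed de Bruijn graph. -/
def IsAut (d n : ℕ) (π : Equiv.Perm (Vtx d n)) : Prop :=
  ∀ x y : Vtx d n, adj d n x y ↔ adj d n (π x) (π y)

/-- `S` is a determining set. -/
def IsDetSet (d n : ℕ) (S : Set (Vtx d n)) : Prop :=
  ∀ π : Equiv.Perm (Vtx d n), IsAut d n π → (∀ s ∈ S, π s = s) → π = 1

/-- The determining number: minimum size of a determining set. -/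
noncomputable def detNum (d n : ℕ) : ℕ :=
  sInf {k : ℕ | ∃ S : Set (Vtx d n), IsDetSet d n S ∧ S.ncard = k}

/-- `w` (of length `N`) has period length `ℓ` (a positive period is intended):
`N ≥ 2ℓ` and `w_i = w_{i+ℓ}` for all valid `i` (paper is 1-indexed, here 0-indexed). -/
def HasPeriod {d N : ℕ} (w : Fin N → Fin d) (ℓ : ℕ) : Prop :=
  2 * ℓ ≤ N ∧ ∀ (i : ℕ) (h : i + ℓ < N), w ⟨i, by omega⟩ = w ⟨i + ℓ, h⟩

/-- `w` is `ℓ`-periodic: it has period length `ℓ` but no (positive) period length `k < ℓ`. -/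
def IsPeriodic {d N : ℕ} (w : Fin N → Fin d) (ℓ : ℕ) : Prop :=
  HasPeriod w ℓ ∧ ∀ k : ℕ, 1 ≤ k → k < ℓ → ¬ HasPeriod w k

/-- `w` is almost `ℓ`-periodic: `ℓ > N/2` and some extension `w ⊕ w'` of length `2ℓ`
is `ℓ`-periodic. -/
def AlmostPeriodic {d N : ℕ} (w : Fin N → Fin d) (ℓ : ℕ) : Prop :=
  N < 2 * ℓ ∧ ∃ w' : Fin (2 * ℓ - N) → Fin d, IsPeriodic (Fin.append w w') ℓ

/-- `w^{(k,m)}` where `k` is the 0-indexed position: add `m` (mod `d`) to the `k`-th letter.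
(The paper's 1-indexed `w^{(k,m)}` is `modify w (k-1) m` here.) -/
def modify {d N : ℕ} (w : Fin N → Fin d) (k : ℕ) (m : Fin d) : Fin N → Fin d :=
  fun i => if i.val = k then w i + m else w i

/-- `w(a:b)`: the substring `w_a w_{a+1} ⋯ w_b`, with `a`, `b` 1-indexed as in the paper. -/
def substr {d N : ℕ} (w : Fin N → Fin d) (a b : ℕ) (ha : 1 ≤ a) (hb : b ≤ N) :
    Fin (b + 1 - a) → Fin d :=
  fun i => w ⟨a - 1 + i.val, by have := i.isLt; omega⟩

/-- A walk of positive length can be redirected to any vertex agreeing with its endpoint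
on all letters but the last. -/
theorem hasWalk.congr_end {d n k : ℕ} {w u v : Vtx d n} (hwu : w ≠ u)
    (h : ∀ (i : ℕ) (hi : i + 1 < n), u ⟨i, by omega⟩ = v ⟨i, by omega⟩)
    (hw : hasWalk d n k w u) : hasWalk d n k w v := by
  obtain ⟨f, h0, hk, hf⟩ := hw
  have hk0 : k ≠ 0 := by
    rintro rfl
    exact hwu (h0.symm.trans hk)
  refine ⟨Function.update f k v, ?_, by simp, fun i hi => ?_⟩
  · rw [Function.update_of_ne hk0.symm, h0]
  · rw [Function.update_of_ne hi.ne]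
    by_cases hik : i + 1 = k
    · rw [hik, Function.update_self]
      intro j hj
      rw [hf i hi j hj, hik, hk, h j hj]
    · rw [Function.update_of_ne hik]
      exact hf i hi

theorem dirDist_congr_end {d n : ℕ} {w u v : Vtx d n} (hwu : w ≠ u) (hwv : w ≠ v)
    (h : ∀ (i : ℕ) (hi : i + 1 < n), u ⟨i, by omega⟩ = v ⟨i, by omega⟩) :
    dirDist d n w u = dirDist d n w v := by
  unfold dirDist
  congr 1
  ext k
  exact ⟨hasWalk.congr_end hwu h, hasWalk.congr_end hwv fun i hi => (h i hi).symm⟩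

/-- Two vertices outside an identifying code never share their first `n - 1` letters. -/
theorem IsIdCode.injOn_init_compl {d m t : ℕ} {S : Set (Vtx d (m + 1))}
    (hS : IsIdCode d (m + 1) t S) :
    Set.InjOn (fun v : Vtx d (m + 1) => (Fin.init v : Vtx d m)) Sᶜ := by
  intro u hu v hv huv
  by_contra hne
  refine hS.2 u v hne (Set.ext fun w => and_congr_left fun hw => ?_)
  have h := dirDist_congr_end (w := w) (u := u) (v := v) (fun e => hu (e ▸ hw))
    (fun e => hv (e ▸ hw)) fun i hi => congrFun huv ⟨i, by omega⟩
  simp only [inBall, Set.mem_ofPred_eq, h]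

/-- if `B⃗(d,n)` has a `t`-identifying code, then every `t`-identifying
code has cardinality at least `d^{n−1}(d−1)`. -/
theorem stmt0 (d n t : ℕ) (hd : 2 ≤ d) (hn : 1 ≤ n) (ht : 1 ≤ t) (htn : t ≤ n)
    (hident : ∃ S : Set (Vtx d n), IsIdCode d n t S) :
    ∀ S : Set (Vtx d n), IsIdCode d n t S → d ^ (n - 1) * (d - 1) ≤ S.ncard := by
  intro S hS
  obtain ⟨m, rfl⟩ : ∃ m, n = m + 1 := ⟨n - 1, by omega⟩
  have hcompl : Sᶜ.ncard ≤ d ^ m := by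
    have := Set.ncard_le_ncard_of_injOn (t := Set.univ) _ (fun _ _ => Set.mem_univ _)
      hS.injOn_init_compl
    simpa [Set.ncard_univ] using this
  have htotal := Set.ncard_add_ncard_compl S
  rw [Nat.card_eq_fintype_card, Fintype.card_pi_const, Fintype.card_fin, pow_succ] at htotal
  rw [Nat.add_sub_cancel, Nat.mul_sub, mul_one]
  omega

end DeBruijnPaper
end

section
/- Suppose n ≥ 5, d ≥ 2, t ≥ 2, and n ≥ 2t. Define S ⊆ A_d^n as the union of the set of all x ∈ A_d^n such that for some m ∈ A_d and some ℓ with 1 ≤ ℓ ≤ t the substring x^{(t,m)}(t+1−ℓ : n−1) is ℓ-periodic but x^{(t,m)}(t+1−ℓ : n−1) ⊕ (x_n+m mod d) is not ℓ-periodic, together with the set of all x ∈ A_d^n such that x_t ≠ x_n and for every m ∈ A_d and every ℓ with 1 ≤ ℓ ≤ t the substring x^{(t,m)}(t+1−ℓ : n−1) is not ℓ-periodic. Then S is a t-identifying code of the directed de Bruijn graph B⃗(d,n) of cardinality d^{n−1}(d−1). -/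
/- Common framework: the directed de Bruijn graph B⃗(d,n).
Vertices are strings of length `n` over the alphabet `A_d = Fin d`,
modelled as functions `Fin n → Fin d` (0-indexed; the paper's 1-indexed
position `i` corresponds to index `i - 1` here). -/

namespace DeBruijnPaper

/-- `X` has period `k` on the index interval `[a, b)`. -/
def PeriodOn {α : Type*} (X : ℕ → α) (a b k : ℕ) : Prop :=
  ∀ i, a ≤ i → i + k < b → X i = X (i + k)

/-- The Fine–Wilf theorem for words of the minimal length `p + q - 1`, with the positions of the
word shifted so that the removed letter is the one at position `0`. -/
theorem fine_wilf {α : Type*} (u : ℕ → α) (p q : ℕ) (hp : 0 < p) (hq : 0 < q)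
    (h₁ : ∀ i, 0 < i → i < q → u i = u (i + p)) (h₂ : ∀ i, 0 < i → i < p → u i = u (i + q))
    (i j : ℕ) (hi : 0 < i) (hi' : i < p + q) (hj : 0 < j) (hj' : j < p + q)
    (hij : i ≡ j [MOD Nat.gcd p q]) : u i = u j := by
  induction hN : p + q using Nat.strong_induction_on generalizing p q i j with
  | _ N ih =>
    wlog hpq : p ≤ q generalizing p q
    · exact this q p hq hp h₂ h₁ (by omega) (by omega) (by rwa [Nat.gcd_comm]) (by omega)
        (by omega)
    rcases hpq.eq_or_lt with rfl | hlt
    · rw [Nat.gcd_self] at hij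
      have key : ∀ i, 0 < i → i < p + p → u i = u (if i ≤ p then i else i - p) := by
        intro i hi hi'
        split_ifs with h
        · rfl
        · have := h₁ (i - p) (by omega) (by omega)
          rw [this]; congr 1; omega
      rw [key i hi hi', key j hj hj']
      congr 1
      have e : ∀ i, 0 < i → i < p + p → (if i ≤ p then i else i - p) =
          if i % p = 0 then p else i % p := by
        intro i hi hi'
        rcases lt_trichotomy i p with h | h | h
        · rw [Nat.mod_eq_of_lt h]; simp [h.le]; omega
        · simp [h]
        · rw [Nat.mod_eq_sub_mod h.le, Nat.mod_eq_of_lt (by omega)]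
          rw [if_neg (by omega), if_neg (by omega)]
      rw [e i hi hi', e j hj hj', show i % p = j % p from hij]
    · have reduce : ∀ i, 0 < i → i < p + q → ∃ i', 0 < i' ∧ i' < q ∧ u i = u i' ∧
          i ≡ i' [MOD Nat.gcd p q] := by
        intro i hi hi'
        by_cases h : i < q
        · exact ⟨i, hi, h, rfl, rfl⟩
        · refine ⟨i - p, by omega, by omega, ?_, ?_⟩
          · rw [h₁ (i - p) (by omega) (by omega)]; congr 1; omega
          · refine ((Nat.modEq_iff_dvd' (by omega)).2 ?_).symm
            rw [show i - (i - p) = p by omega]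
            exact Nat.gcd_dvd_left p q
      obtain ⟨i', hi0, hiq, hui, hmi⟩ := reduce i hi hi'
      obtain ⟨j', hj0, hjq, huj, hmj⟩ := reduce j hj hj'
      rw [hui, huj]
      refine ih q (by omega) p (q - p) hp (by omega) (fun k hk hk' => h₁ k hk (by omega)) ?_ i' j'
        hi0 (by omega) hj0 (by omega) ?_ (by omega)
      · intro k hk hk'
        rw [h₂ k hk hk', h₁ (k + (q - p)) (by omega) (by omega)]
        congr 1; omega
      · rw [Nat.gcd_sub_self_right hpq]
        exact hmi.symm.trans (hij.trans hmj)

theorem PeriodOn.eq_mod {α : Type*} {Z : ℕ → α} {A b l : ℕ} (h : PeriodOn Z A b l) (e : ℕ)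
    (he : A + e < b) : Z (A + e) = Z (A + e % l) := by
  induction e using Nat.strong_induction_on with
  | _ e ih =>
    rcases Nat.eq_zero_or_pos l with rfl | hl
    · simp
    by_cases hel : e < l
    · rw [Nat.mod_eq_of_lt hel]
    · rw [Nat.mod_eq_sub_mod (by omega), ← ih (e - l) (by omega) (by omega),
        h (A + (e - l)) (by omega) (by omega)]
      congr 1; omega

/-- If the first full period of `Z` has itself a period dividing it, then so has `Z`. -/
theorem PeriodOn.of_dvd {α : Type*} {Z : ℕ → α} {A b l g : ℕ} (h : PeriodOn Z A b l) (hl : 0 < l)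
    (hg : g ∣ l) (hZ : ∀ e f, e < l → f < l → e ≡ f [MOD g] → Z (A + e) = Z (A + f)) :
    PeriodOn Z A b g := by
  intro i hi hib
  obtain ⟨e, rfl⟩ := Nat.exists_eq_add_of_le hi
  rw [add_assoc, h.eq_mod e (by omega), h.eq_mod (e + g) (by omega)]
  refine hZ _ _ (Nat.mod_lt _ hl) (Nat.mod_lt _ hl) ?_
  have h1 : e % l ≡ e [MOD g] := (Nat.mod_modEq e l).of_dvd hg
  have h2 : (e + g) % l ≡ e + g [MOD g] := (Nat.mod_modEq (e + g) l).of_dvd hg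
  refine h1.trans (Nat.ModEq.trans ?_ h2.symm)
  simp [Nat.ModEq]

/-- A word with a hole at position `s`, having periods `p < l` around the hole. -/
theorem eq_of_two_periods {α : Type*} (X : ℕ → α) (s p l : ℕ) (hp : 0 < p) (hpl : p < l)
    (h₁ : ∀ r, 0 < r → r < l - p → X (s + r) = X (s + r + p))
    (h₂ : ∀ r, 0 < r → r < p → X (s + r - p) = X (s + r))
    (h₃ : ∀ r, 0 < r → r < l → X (s + r - l) = X (s + r))
    (i j : ℕ) (hi : 0 < i) (hi' : i < l) (hj : 0 < j) (hj' : j < l)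
    (hij : i ≡ j [MOD Nat.gcd p l]) : X (s + i) = X (s + j) := by
  refine fine_wilf (fun r => X (s + r)) p (l - p) hp (by omega) (fun r hr hr' => ?_)
    (fun r hr hr' => ?_) i j hi (by omega) hj (by omega) ?_
  · simpa [add_assoc] using h₁ r hr hr'
  · have := h₃ (r + (l - p)) (by omega) (by omega)
    rw [← h₂ r hr hr', ← this]
    congr 1; omega
  · rwa [Nat.gcd_sub_self_right hpl.le]

section Sequences

variable {G : Type*}

/-- The word obtained from `X` by writing `a` at index `t - 1` is `l`-periodic on the indices
`t - l, …, n - 2`. -/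
structure IsPeriodicAt (n t : ℕ) (X : ℕ → G) (l : ℕ) (a : G) : Prop where
  pos : 1 ≤ l
  le : l ≤ t
  bound : l + t + 1 ≤ n
  period : PeriodOn (Function.update X (t - 1) a) (t - l) (n - 1) l
  minimal : ∀ k, 1 ≤ k → k < l → ¬ PeriodOn (Function.update X (t - 1) a) (t - l) (n - 1) k

namespace IsPeriodicAt

variable {n t l l' : ℕ} {X Y : ℕ → G} {a a' : G}

theorem congr (h : IsPeriodicAt n t X l a) (hXY : ∀ i, i < n - 1 → i ≠ t - 1 → X i = Y i) :
    IsPeriodicAt n t Y l a := by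
  have key : ∀ i, i < n - 1 →
      Function.update X (t - 1) a i = Function.update Y (t - 1) a i := by
    intro i hi
    by_cases his : i = t - 1
    · simp [his]
    · simp [his, hXY i hi his]
  refine ⟨h.pos, h.le, h.bound, fun i hi hib => ?_, fun k hk hkl hper => ?_⟩
  · rw [← key i (by omega), ← key (i + l) hib]
    exact h.period i hi hib
  · refine h.minimal k hk hkl fun i hi hib => ?_
    rw [key i (by omega), key (i + k) hib]
    exact hper i hi hib

theorem apply_eq (h : IsPeriodicAt n t X l a) {i : ℕ} (hi : t - l ≤ i) (his : i ≠ t - 1)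
    (his' : i + l ≠ t - 1) (hib : i + l < n - 1) : X i = X (i + l) := by
  simpa [his, his'] using h.period i hi hib

theorem letter_eq (h : IsPeriodicAt n t X l a) : a = X (t - 1 + l) := by
  have hpos := h.pos
  have hle := h.le
  have hb := h.bound
  simpa [show l ≠ 0 by omega] using h.period (t - 1) (by omega) (by omega)

theorem not_length_lt (h : IsPeriodicAt n t X l a) (h' : IsPeriodicAt n t X l' a') : ¬ l < l' := by
  intro hlt
  have hpos := h.pos
  have hle' := h'.le
  have hb' := h'.bound
  have core := eq_of_two_periods X (t - 1) l l' h.pos hlt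
    (fun r hr hr' => h.apply_eq (by omega) (by omega) (by omega) (by omega))
    (fun r hr hr' => by
      rw [h.apply_eq (i := t - 1 + r - l) (by omega) (by omega) (by omega) (by omega)]
      congr 1; omega)
    (fun r hr hr' => by
      rw [h'.apply_eq (i := t - 1 + r - l') (by omega) (by omega) (by omega) (by omega)]
      congr 1; omega)
  have hend : X (t - 1 + l') = X (t - 1 + (l' - l)) := by
    rw [h.apply_eq (i := t - 1 + (l' - l)) (by omega) (by omega) (by omega) (by omega)]
    congr 1; omega
  have hdvd : (l' - l) ≡ l' [MOD Nat.gcd l l'] := by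
    refine (Nat.modEq_iff_dvd' (by omega)).2 ?_
    rw [show l' - (l' - l) = l by omega]
    exact Nat.gcd_dvd_left l l'
  have full : ∀ i j, 0 < i → i ≤ l' → 0 < j → j ≤ l' → i ≡ j [MOD Nat.gcd l l'] →
      X (t - 1 + i) = X (t - 1 + j) := by
    intro i j hi hi' hj hj' hij
    rcases hi'.eq_or_lt with rfl | hi' <;> rcases hj'.eq_or_lt with rfl | hj'
    · rfl
    · rw [hend]
      exact core _ _ (by omega) (by omega) hj hj' (hdvd.trans hij)
    · rw [hend]
      exact core _ _ hi hi' (by omega) (by omega) (hij.trans hdvd.symm)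
    · exact core _ _ hi hi' hj hj' hij
  refine h'.minimal (Nat.gcd l l') (Nat.gcd_pos_of_pos_left _ h.pos)
    ((Nat.gcd_le_left _ h.pos).trans_lt hlt)
    (h'.period.of_dvd (by omega) (Nat.gcd_dvd_right l l') fun e f he hf hef => ?_)
  have shift : ∀ e, e < l' → Function.update X (t - 1) a' (t - l' + e) = X (t - 1 + (e + 1)) := by
    intro e he
    have hper := h'.period (t - l' + e) (by omega) (by omega)
    rw [hper, Function.update_of_ne (by omega)]
    congr 1; omega
  rw [shift e he, shift f hf]
  exact full _ _ (by omega) (by omega) (by omega) (by omega) (hef.add_right 1)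

theorem unique (h : IsPeriodicAt n t X l a) (h' : IsPeriodicAt n t X l' a') :
    l = l' ∧ a = a' := by
  have hl : l = l' := le_antisymm (not_lt.1 (h'.not_length_lt h)) (not_lt.1 (h.not_length_lt h'))
  refine ⟨hl, ?_⟩
  rw [h.letter_eq, h'.letter_eq, hl]

end IsPeriodicAt

/-- Membership in the in-ball, for words given as the first `n` letters of a sequence. -/
def InBall (n t : ℕ) (X V : ℕ → G) : Prop :=
  ∃ j ≤ t, ∀ i, i + j < n → X (i + j) = V i

variable [AddCommGroup G]

/-- Membership in the code, for words given as the first `n` letters of a sequence. -/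
def InCode (n t : ℕ) (X : ℕ → G) : Prop :=
  (∃ l a, IsPeriodicAt n t X l a ∧ X (n - 1) + (a - X (t - 1)) ≠ X (n - 1 - l)) ∨
    X (t - 1) ≠ X (n - 1) ∧ ∀ l a, ¬ IsPeriodicAt n t X l a

variable {n t : ℕ} {X Y V V' : ℕ → G}

theorem IsPeriodicAt.inCode_iff {l : ℕ} {a : G} (h : IsPeriodicAt n t X l a) :
    InCode n t X ↔ X (n - 1) + (a - X (t - 1)) ≠ X (n - 1 - l) := by
  constructor
  · rintro (⟨l', a', h', hne⟩ | ⟨-, hno⟩)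
    · obtain ⟨rfl, rfl⟩ := h.unique h'
      exact hne
    · exact absurd h (hno l a)
  · exact fun hne => Or.inl ⟨l, a, h, hne⟩

theorem inCode_iff_of_forall_not (h : ∀ l a, ¬ IsPeriodicAt n t X l a) :
    InCode n t X ↔ X (t - 1) ≠ X (n - 1) := by
  constructor
  · rintro (⟨l, a, h', -⟩ | ⟨hne, -⟩)
    · exact absurd h' (h l a)
    · exact hne
  · exact fun hne => Or.inr ⟨hne, h⟩

theorem InCode.congr (ht : 1 ≤ t) (hnt : t < n) (h : InCode n t X) (hXY : ∀ i < n, X i = Y i) :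
    InCode n t Y := by
  by_cases hP : ∃ l a, IsPeriodicAt n t X l a
  · obtain ⟨l, a, hP⟩ := hP
    have hP' := hP.congr (Y := Y) fun i hi _ => hXY i (by omega)
    rw [hP'.inCode_iff, ← hXY _ (by omega), ← hXY _ (by omega), ← hXY _ (by omega)]
    exact hP.inCode_iff.1 h
  · push Not at hP
    rw [inCode_iff_of_forall_not fun l a hY => hP l a
        (hY.congr fun i hi _ => (hXY i (by omega)).symm),
      ← hXY _ (by omega), ← hXY _ (by omega)]
    exact (inCode_iff_of_forall_not hP).1 h

/-- Exactly one value of the letter at index `t - 1` is excluded by the code. -/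
theorem exists_excluded_letter (ht : 1 ≤ t) (hnt : t < n) (X : ℕ → G) :
    ∃ e, ∀ Y : ℕ → G, (∀ i < n, i ≠ t - 1 → X i = Y i) → (InCode n t Y ↔ Y (t - 1) ≠ e) := by
  by_cases hP : ∃ l a, IsPeriodicAt n t X l a
  · obtain ⟨l, a, hP⟩ := hP
    have hpos := hP.pos
    have hb := hP.bound
    refine ⟨X (n - 1) + a - X (n - 1 - l), fun Y hXY => ?_⟩
    rw [(hP.congr (Y := Y) fun i hi => hXY i (by omega)).inCode_iff,
      ← hXY (n - 1) (by omega) (by omega), ← hXY (n - 1 - l) (by omega) (by omega),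
      not_iff_not, eq_sub_iff_add_eq, ← add_sub_assoc, sub_eq_iff_eq_add, eq_comm,
      add_comm (Y (t - 1))]
  · push Not at hP
    refine ⟨X (n - 1), fun Y hXY => ?_⟩
    rw [inCode_iff_of_forall_not fun l a hY => hP l a
      (hY.congr fun i hi his => (hXY i (by omega) his).symm), hXY (n - 1) (by omega) (by omega)]

/-- Exactly one value of the last letter is excluded by the code. -/
theorem exists_excluded_last (ht : 1 ≤ t) (hnt : t < n) (X : ℕ → G) :
    ∃ e, ∀ Y : ℕ → G, (∀ i < n - 1, X i = Y i) → (InCode n t Y ↔ Y (n - 1) ≠ e) := by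
  by_cases hP : ∃ l a, IsPeriodicAt n t X l a
  · obtain ⟨l, a, hP⟩ := hP
    have hpos := hP.pos
    have hb := hP.bound
    refine ⟨X (n - 1 - l) - (a - X (t - 1)), fun Y hXY => ?_⟩
    rw [(hP.congr (Y := Y) fun i hi _ => hXY i hi).inCode_iff,
      ← hXY (t - 1) (by omega), ← hXY (n - 1 - l) (by omega), not_iff_not, eq_sub_iff_add_eq]
  · push Not at hP
    refine ⟨X (t - 1), fun Y hXY => ?_⟩
    by_cases htn : t - 1 < n - 1
    · rw [inCode_iff_of_forall_not fun l a hY => hP l a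
        (hY.congr fun i hi _ => (hXY i hi).symm), hXY (t - 1) htn, ne_comm]
    · omega

/-- A word with period `l` up to its last letter is not in the code. -/
theorem PeriodOn.not_inCode (hn2 : 2 * t ≤ n) (ht : 2 ≤ t) {l : ℕ} (hl : 1 ≤ l) (hlt : l ≤ t)
    (h : PeriodOn X (t - l) n l) : ¬ InCode n t X := by
  classical
  by_cases hb : l + t + 1 ≤ n
  · have hex : ∃ k, 1 ≤ k ∧ PeriodOn X (t - k) (n - 1) k :=
      ⟨l, hl, fun i hi hib => h i hi (by omega)⟩
    obtain ⟨hk, hper⟩ := Nat.find_spec hex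
    have hmin : ∀ k < Nat.find hex, ¬ (1 ≤ k ∧ PeriodOn X (t - k) (n - 1) k) :=
      fun k hk => Nat.find_min hex hk
    have hkl : Nat.find hex ≤ l := Nat.find_min' hex ⟨hl, fun i hi hib => h i hi (by omega)⟩
    generalize Nat.find hex = k at hk hper hmin hkl
    have hP : IsPeriodicAt n t X k (X (t - 1)) := by
      refine ⟨hk, by omega, by omega, ?_, ?_⟩
      · rwa [Function.update_eq_self]
      · intro k' hk' hlt' hper'
        rw [Function.update_eq_self] at hper'
        exact hmin k' hlt' ⟨hk', fun i hi hib => hper' i (by omega) hib⟩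
    rw [hP.inCode_iff, not_not, sub_self, add_zero]
    by_cases hkl' : k = l
    · subst hkl'
      rw [h (n - 1 - k) (by omega) (by omega)]
      congr 1; omega
    · have e1 := h (n - 1 - l) (by omega) (by omega)
      have e2 := hper (n - 1 - l - k) (by omega) (by omega)
      have e3 := h (n - 1 - l - k) (by omega) (by omega)
      rw [show n - 1 - l + l = n - 1 by omega] at e1
      rw [show n - 1 - l - k + k = n - 1 - l by omega] at e2
      rw [show n - 1 - l - k + l = n - 1 - k by omega] at e3
      rw [← e1, ← e2, e3]
  · obtain rfl : l = t := by omega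
    obtain rfl : n = 2 * l := by omega
    have hlast : X (l - 1) = X (2 * l - 1) := by
      rw [h (l - 1) (by omega) (by omega)]
      congr 1; omega
    by_cases hP : ∃ k a, IsPeriodicAt (2 * l) l X k a
    · obtain ⟨k, a, hP⟩ := hP
      have hpos := hP.pos
      have hkb := hP.bound
      rw [hP.inCode_iff, not_not, hlast, add_sub_cancel, hP.letter_eq,
        show 2 * l - 1 - k = l - 1 + (l - k) by omega]
      refine eq_of_two_periods X (l - 1) k l hpos (by omega)
        (fun r hr hr' => hP.apply_eq (by omega) (by omega) (by omega) (by omega))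
        (fun r hr hr' => ?_) (fun r hr hr' => ?_) _ _ hpos (by omega) (by omega) (by omega) ?_
      · rw [hP.apply_eq (i := l - 1 + r - k) (by omega) (by omega) (by omega) (by omega)]
        congr 1; omega
      · rw [h (l - 1 + r - l) (by omega) (by omega)]
        congr 1; omega
      · have h1 : k ≡ 0 [MOD Nat.gcd k l] :=
          (Nat.modEq_zero_iff_dvd).2 (Nat.gcd_dvd_left k l)
        have h2 : l - k ≡ 0 [MOD Nat.gcd k l] :=
          (Nat.modEq_zero_iff_dvd).2 (Nat.dvd_sub (Nat.gcd_dvd_right k l) (Nat.gcd_dvd_left k l))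
        exact h1.trans h2.symm
    · push Not at hP
      rw [inCode_iff_of_forall_not hP, not_not, hlast]

theorem exists_inCode_inBall (ht : 1 ≤ t) (hnt : t < n) [Nontrivial G] (V : ℕ → G) (c : G) :
    ∃ X : ℕ → G, InCode n t X ∧ (∀ i < t - 1, X i = c) ∧ ∀ i, X (i + t) = V i := by
  obtain ⟨e, he⟩ := exists_excluded_letter (n := n) ht hnt
    (fun i => if i < t - 1 then c else V (i - t))
  obtain ⟨b, hb⟩ := exists_ne e
  refine ⟨Function.update (fun i => if i < t - 1 then c else V (i - t)) (t - 1) b,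
    (he _ fun i _ hi => by simp [hi]).2 (by simpa using hb), fun i hi => ?_, fun i => ?_⟩
  · simp [hi, hi.ne]
  · rw [Function.update_of_ne (by omega), if_neg (by omega), Nat.add_sub_cancel]

/-- Separation of vertices whose first `n - t` letters agree. -/
theorem not_inBall_of_prefix (hn2 : 2 * t ≤ n) (ht : 2 ≤ t) {k : ℕ} (hk : k < n) (hkt : n - t ≤ k)
    (hV : ∀ i < k, V i = V' i) (hne : V k ≠ V' k) {c : G} (hc : c ≠ V' 0)
    (hX : ∀ i < n - 1 - k, X i = c) (hXV : ∀ i, X (i + (n - 1 - k)) = V i)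
    (hS : InCode n t X) : ¬ InBall n t X V' := by
  rintro ⟨j, hj, hball⟩
  rcases lt_trichotomy j (n - 1 - k) with hlt | rfl | hgt
  · have := hball 0 (by omega)
    rw [zero_add, hX j hlt] at this
    exact hc this
  · exact hne (by rw [← hXV k, hball k (by omega)])
  · refine PeriodOn.not_inCode (l := j - (n - 1 - k)) hn2 ht (by omega) (by omega) ?_ hS
    intro i hi hib
    have h1 := hball (i - (n - 1 - k)) (by omega)
    have h2 := hXV (i - (n - 1 - k))
    rw [show i - (n - 1 - k) + j = i + (j - (n - 1 - k)) by omega] at h1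
    rw [show i - (n - 1 - k) + (n - 1 - k) = i by omega] at h2
    rw [h1, h2, hV _ (by omega)]

theorem shift_of_forall_inBall [Nontrivial G] (ht : 2 ≤ t) (hnt : t < n)
    (hne : ∃ i < n - t, V i ≠ V' i)
    (h : ∀ X : ℕ → G, InCode n t X → InBall n t X V → InBall n t X V') :
    ∀ i, i + t < n → V i = V' (i + 1) := by
  obtain ⟨c, hc⟩ := exists_ne (V' 0)
  obtain ⟨X, hS, hXc, hXV⟩ := exists_inCode_inBall (n := n) (t := t) (by omega) hnt V c
  obtain ⟨j, hj, hball⟩ := h X hS ⟨t, le_rfl, fun i _ => hXV i⟩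
  rcases hj.eq_or_lt with rfl | hj
  · obtain ⟨i, hi, hne⟩ := hne
    exact absurd ((hXV i).symm.trans (hball i (by omega))) hne
  · by_cases hjt : j < t - 1
    · have := hball 0 (by omega)
      rw [zero_add, hXc j hjt] at this
      exact absurd this hc
    · intro i hi
      rw [← hXV i, ← hball (i + 1) (by omega)]
      congr 1; omega

theorem exists_separating_of_prefix_ne [Nontrivial G] (hn : 5 ≤ n) (hn2 : 2 * t ≤ n) (ht : 2 ≤ t)
    (hne : ∃ i < n - t, V i ≠ V' i) :
    ∃ X : ℕ → G, InCode n t X ∧ ¬ (InBall n t X V ↔ InBall n t X V') := by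
  by_contra! hcon
  have h₁ := shift_of_forall_inBall ht (by omega) hne fun X hX => (hcon X hX).1
  have h₂ := shift_of_forall_inBall (V := V') (V' := V) ht (by omega)
    (hne.imp fun i hi => ⟨hi.1, hi.2.symm⟩) fun X hX => (hcon X hX).2
  have hab : V 0 ≠ V' 0 := by
    intro h0
    have all : ∀ i, i < n - t → V i = V 0 ∧ V' i = V 0 := by
      intro i
      induction i with
      | zero => exact fun _ => ⟨rfl, h0.symm⟩
      | succ i ih =>
        intro hi
        obtain ⟨e1, e2⟩ := ih (by omega)
        exact ⟨by rw [← h₂ i (by omega), e2], by rw [← h₁ i (by omega), e1]⟩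
    obtain ⟨i, hi, hne⟩ := hne
    exact hne ((all i hi).1.trans (all i hi).2.symm)
  have hV1 : V 1 = V' 0 := (h₂ 0 (by omega)).symm
  have hV2 : ∀ i, i + 1 + t < n → V i = V (i + 2) := fun i hi => by
    rw [h₁ i (by omega), h₂ (i + 1) hi]
  set X : ℕ → G := fun i => if i < t then V 0 else V (i - t) with hXdef
  have hlow : ∀ i < t, X i = V 0 := fun i hi => by simp [hXdef, hi]
  have hhigh : ∀ i, X (i + t) = V i := fun i => by simp [hXdef]
  have hhigh' : ∀ i, t ≤ i → X i = V (i - t) := fun i hi => by simp [hXdef, hi.not_gt]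
  have hP : IsPeriodicAt n t X 2 (V' 0) := by
    refine ⟨by omega, ht, by omega, fun i hi hib => ?_, fun k hk hk2 hper => ?_⟩
    · rw [Function.update_of_ne (show i + 2 ≠ t - 1 by omega), hhigh' (i + 2) (by omega)]
      by_cases h1 : i = t - 1
      · rw [h1, Function.update_self, show t - 1 + 2 - t = 1 by omega, hV1]
      · rw [Function.update_of_ne h1]
        by_cases h2 : i < t
        · rw [hlow i h2, show i + 2 - t = 0 by omega]
        · rw [hhigh' i (by omega), hV2 _ (by omega)]
          congr 1; omega
    · obtain rfl : k = 1 := by omega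
      have := hper (t - 2) le_rfl (by omega)
      rw [Function.update_of_ne (by omega), show t - 2 + 1 = t - 1 by omega,
        Function.update_self, hlow _ (by omega)] at this
      exact hab this
  have hS : InCode n t X := by
    rw [hP.inCode_iff, hlow (t - 1) (by omega), hhigh' (n - 1) (by omega),
      hhigh' (n - 1 - 2) (by omega), hV2 (n - 1 - 2 - t) (by omega),
      show n - 1 - 2 - t + 2 = n - 1 - t by omega]
    simpa [sub_eq_zero] using hab.symm
  obtain ⟨j, hj, hball⟩ := (hcon X hS).1 ⟨t, le_rfl, fun i _ => hhigh i⟩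
  have h0 := hball 0 (by omega)
  rw [zero_add] at h0
  rcases hj.eq_or_lt with rfl | hj
  · rw [← h0, ← hhigh 0, zero_add] at hab
    exact hab rfl
  · rw [hlow j hj] at h0
    exact hab h0

theorem exists_separating [Nontrivial G] (hn : 5 ≤ n) (hn2 : 2 * t ≤ n) (ht : 2 ≤ t)
    (hne : ∃ i < n, V i ≠ V' i) :
    ∃ X : ℕ → G, InCode n t X ∧ ¬ (InBall n t X V ↔ InBall n t X V') := by
  classical
  by_cases hpre : ∃ i < n - t, V i ≠ V' i
  · exact exists_separating_of_prefix_ne hn hn2 ht hpre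
  push Not at hpre
  obtain ⟨hk, hVk⟩ := Nat.find_spec hne
  have hmin : ∀ i < Nat.find hne, V i = V' i := fun i hi => by
    by_contra h
    exact Nat.find_min hne hi ⟨hi.trans hk, h⟩
  generalize Nat.find hne = k at hk hVk hmin
  have hkt : n - t ≤ k := by
    by_contra h
    exact hVk (hpre k (by omega))
  have h0 : V 0 = V' 0 := hmin 0 (by omega)
  obtain ⟨c, hc⟩ := exists_ne (V 0)
  let W : (ℕ → G) → ℕ → G := fun U i => if i < n - 1 - k then c else U (i - (n - 1 - k))
  have hlow : ∀ U, ∀ i < n - 1 - k, W U i = c := fun U i hi => by simp [W, hi]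
  have hhigh : ∀ U i, W U (i + (n - 1 - k)) = U i := fun U i => by simp [W]
  have hball : ∀ U, InBall n t (W U) U := fun U => ⟨n - 1 - k, by omega, fun i _ => hhigh U i⟩
  obtain ⟨e, he⟩ := exists_excluded_last (n := n) (t := t) (by omega) (by omega) (W V)
  have hlast : ∀ U, W U (n - 1) = U k := fun U => by
    rw [← hhigh U k]; congr 1; omega
  by_cases hVe : V k = e
  · have hS : InCode n t (W V') := by
      refine (he _ fun i hi => ?_).2 (by rw [hlast, ← hVe]; exact hVk.symm)
      by_cases hik : i < n - 1 - k
      · rw [hlow _ i hik, hlow _ i hik]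
      · simp only [W, hik, if_false]
        exact hmin _ (by omega)
    exact ⟨W V', hS, fun hiff => not_inBall_of_prefix hn2 ht hk hkt (fun i hi => (hmin i hi).symm)
      hVk.symm hc (hlow V') (hhigh V') hS (hiff.2 (hball V'))⟩
  · have hS : InCode n t (W V) := (he _ fun i _ => rfl).2 (by rwa [hlast])
    exact ⟨W V, hS, fun hiff => not_inBall_of_prefix hn2 ht hk hkt hmin hVk (h0 ▸ hc) (hlow V)
      (hhigh V) hS (hiff.1 (hball V))⟩

end Sequences

section Bridge

variable {d n t : ℕ}

theorem hasWalk_iff (j : ℕ) (u v : Vtx d n) :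
    hasWalk d n j u v ↔ ∀ (i : ℕ) (h : i + j < n), u ⟨i + j, h⟩ = v ⟨i, by omega⟩ := by
  constructor
  · rintro ⟨f, rfl, rfl, hf⟩
    have key : ∀ k ≤ j, ∀ (i : ℕ) (h : i + k < n), f 0 ⟨i + k, h⟩ = f k ⟨i, by omega⟩ := by
      intro k
      induction k with
      | zero => exact fun _ i h => rfl
      | succ k ih =>
        intro hk i h
        rw [← hf k (by omega) i (by omega), ← ih (by omega) (i + 1) (by omega)]
        congr 2; omega
    exact key j le_rfl
  · intro h
    refine ⟨fun k i => if hik : i + k < n then u ⟨i + k, hik⟩ else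
      v ⟨i + k - j - (k - j), by omega⟩, ?_, ?_, ?_⟩
    · funext i
      simp
    · funext i
      by_cases hij : i.val + j < n
      · simp [hij, h]
      · simp [hij]
    · intro k hk i hi
      have e : i + 1 + k = i + (k + 1) := by omega
      simp only [e]
      split_ifs
      · rfl
      · congr 2; omega

theorem mem_inBall_iff (u v : Vtx d n) :
    u ∈ inBall d n t v ↔ ∃ j ≤ t, hasWalk d n j u v := by
  have hne : {j : ℕ | hasWalk d n j u v}.Nonempty :=
    ⟨n, (hasWalk_iff n u v).2 fun i h => by omega⟩
  constructor
  · exact fun h => ⟨_, h, Nat.sInf_mem hne⟩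
  · rintro ⟨j, hj, hw⟩
    exact (Nat.sInf_le hw).trans hj

/-- The sequence extending a string by zeros. -/
def toSeq [NeZero d] (x : Vtx d n) : ℕ → Fin d :=
  fun i => if h : i < n then x ⟨i, h⟩ else 0

theorem toSeq_of_lt [NeZero d] (x : Vtx d n) {i : ℕ} (h : i < n) : toSeq x i = x ⟨i, h⟩ := by
  simp [toSeq, h]

theorem mem_inBall_iff_inBall_toSeq [NeZero d] (u v : Vtx d n) :
    u ∈ inBall d n t v ↔ InBall n t (toSeq u) (toSeq v) := by
  rw [mem_inBall_iff]
  refine exists_congr fun j => and_congr_right fun _ => ?_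
  rw [hasWalk_iff]
  refine forall_congr' fun i => forall_congr' fun h => ?_
  rw [toSeq_of_lt u h, toSeq_of_lt v (by omega)]

theorem modify_eq_update [NeZero d] (x : Vtx d n) (s : ℕ) (m : Fin d) (i : Fin n) :
    modify x s m i = Function.update (toSeq x) s (toSeq x s + m) i := by
  unfold modify
  split_ifs with h
  · rw [← h, Function.update_self, toSeq_of_lt]
  · rw [Function.update_of_ne h, toSeq_of_lt]

theorem hasPeriod_substr_iff [NeZero d] (hn : 2 * t ≤ n) {l : ℕ} (hl : 1 ≤ l) (hlt : l ≤ t)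
    (x : Vtx d n) (m : Fin d) (ha : 1 ≤ t + 1 - l) (hb : n - 1 ≤ n) (k : ℕ) :
    HasPeriod (substr (modify x (t - 1) m) (t + 1 - l) (n - 1) ha hb) k ↔
      2 * k + t + 1 ≤ n + l ∧
        PeriodOn (Function.update (toSeq x) (t - 1) (toSeq x (t - 1) + m)) (t - l) (n - 1) k := by
  unfold HasPeriod substr
  refine and_congr (by omega) ⟨fun h i hi hib => ?_, fun h i hi => ?_⟩
  · have := h (i - (t - l)) (by omega)
    rw [modify_eq_update, modify_eq_update] at this
    convert this using 2 <;> simp only <;> omega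
  · rw [modify_eq_update, modify_eq_update]
    convert h (t - l + i) (by omega) (by omega) using 2 <;> simp only <;> omega

theorem isPeriodic_substr_iff [NeZero d] (hn : 2 * t ≤ n) {l : ℕ} (hl : 1 ≤ l) (hlt : l ≤ t)
    (x : Vtx d n) (m : Fin d) (ha : 1 ≤ t + 1 - l) (hb : n - 1 ≤ n) :
    IsPeriodic (substr (modify x (t - 1) m) (t + 1 - l) (n - 1) ha hb) l ↔
      IsPeriodicAt n t (toSeq x) l (toSeq x (t - 1) + m) := by
  unfold IsPeriodic
  simp only [hasPeriod_substr_iff hn hl hlt]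
  constructor
  · rintro ⟨⟨hb, hper⟩, hmin⟩
    exact ⟨hl, hlt, by omega, hper, fun k hk hkl hk' => hmin k hk hkl ⟨by omega, hk'⟩⟩
  · intro h
    have := h.bound
    exact ⟨⟨by omega, h.period⟩, fun k hk hkl hk' => h.minimal k hk hkl hk'.2⟩

theorem HasPeriod.of_snoc {N k : ℕ} {w : Fin N → Fin d} {c : Fin d} (hk : 2 * k ≤ N)
    (h : HasPeriod (Fin.snoc w c : Fin (N + 1) → Fin d) k) : HasPeriod w k := by
  refine ⟨hk, fun i hi => ?_⟩
  have := h.2 i (by omega)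
  simpa [Fin.snoc, hi, show i < N by omega] using this

theorem IsPeriodic.snoc_iff {N l : ℕ} {w : Fin N → Fin d} (h : IsPeriodic w l) (hl : 1 ≤ l)
    (hN : N - l < N) (c : Fin d) :
    IsPeriodic (Fin.snoc w c : Fin (N + 1) → Fin d) l ↔ c = w ⟨N - l, hN⟩ := by
  have h2 := h.1.1
  constructor
  · intro hs
    have := hs.1.2 (N - l) (by omega)
    simp [Fin.snoc, hN, show N - l + l = N by omega] at this
    exact this.symm
  · intro hc
    refine ⟨⟨by omega, fun i hi => ?_⟩,
      fun k hk hkl hs => h.2 k hk hkl (hs.of_snoc (by omega))⟩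
    by_cases hil : i + l < N
    · simpa [Fin.snoc, hil, show i < N by omega] using h.1.2 i hil
    · obtain rfl : i = N - l := by omega
      simp [Fin.snoc, hN, show N - l + l = N by omega, hc]

/-- A set omitting exactly one value of the letter at position `p`, for each choice of the other
letters. -/
theorem ncard_of_excluded_letter {S : Set (Vtx d n)} (p : Fin n) (hd : 0 < d)
    (h : ∀ x : Vtx d n, ∃ e, ∀ c, Function.update x p c ∈ S ↔ c ≠ e) :
    S.ncard = d ^ (n - 1) * (d - 1) := by
  choose e he using h
  have hinv : ∀ x c, e (Function.update x p c) = e x := by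
    intro x c
    by_contra hne
    have h1 := (he (Function.update x p c) (e x)).2 (Ne.symm hne)
    rw [Function.update_idem] at h1
    exact (he x (e x)).1 h1 rfl
  have hmem : ∀ x, x ∈ Sᶜ ↔ x p = e x := fun x => by
    have := he x (x p)
    rw [Function.update_eq_self] at this
    rw [Set.mem_compl_iff, this, not_not]
  let φ : (Sᶜ : Set (Vtx d n)) × Fin d ≃ Vtx d n :=
    { toFun := fun y => Function.update y.1.1 p y.2
      invFun := fun x => (⟨Function.update x p (e x), by
        rw [hmem, hinv, Function.update_self]⟩, x p)
      left_inv := by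
        rintro ⟨⟨x, hx⟩, c⟩
        rw [hmem] at hx
        simp [hinv, ← hx]
      right_inv := fun x => by simp }
  have hcard := Nat.card_congr φ
  rw [Nat.card_prod, Nat.card_coe_set_eq] at hcard
  simp only [Nat.card_eq_fintype_card, Fintype.card_fun, Fintype.card_fin] at hcard
  have hsum := Set.ncard_add_ncard_compl S
  simp only [Nat.card_eq_fintype_card, Fintype.card_fun, Fintype.card_fin] at hsum
  have hn : 0 < n := p.pos
  obtain ⟨n, rfl⟩ := Nat.exists_eq_add_of_lt hn
  rw [zero_add] at *
  rw [pow_succ] at hcard hsum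
  rw [Nat.eq_of_mul_eq_mul_right hd hcard] at hsum
  rw [Nat.add_sub_cancel, Nat.mul_sub, mul_one]
  omega

end Bridge

/-- Theorem `MPMain`: for `n ≥ 5`, `d ≥ 2`, `t ≥ 2`, `n ≥ 2t`, the given set `S`
is a `t`-identifying code of `B⃗(d,n)` of cardinality `d^{n−1}(d−1)`. -/
theorem stmt1 (d n t : ℕ) (hn : 5 ≤ n) (hd : 2 ≤ d) (ht : 2 ≤ t) (hnt : 2 * t ≤ n)
    (S : Set (Vtx d n))
    (hS : S =
      {x : Vtx d n |
        (∃ m : Fin d, ∃ ℓ : ℕ, ∃ _ : 1 ≤ ℓ, ∃ _ : ℓ ≤ t,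
          IsPeriodic
            (substr (modify x (t - 1) m) (t + 1 - ℓ) (n - 1) (by omega) (by omega)) ℓ ∧
          ¬ IsPeriodic
            (Fin.snoc
              (substr (modify x (t - 1) m) (t + 1 - ℓ) (n - 1) (by omega) (by omega))
              (x ⟨n - 1, by omega⟩ + m)) ℓ) ∨
        (x ⟨t - 1, by omega⟩ ≠ x ⟨n - 1, by omega⟩ ∧
          ∀ m : Fin d, ∀ ℓ : ℕ, 1 ≤ ℓ → ∀ _ : ℓ ≤ t,
            ¬ IsPeriodic
              (substr (modify x (t - 1) m) (t + 1 - ℓ) (n - 1) (by omega) (by omega)) ℓ)}) :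
    IsIdCode d n t S ∧ S.ncard = d ^ (n - 1) * (d - 1) := by
  have : NeZero d := ⟨by omega⟩
  have : Nontrivial (Fin d) := Fin.nontrivial_iff_two_le.2 hd
  have hmem : ∀ x, x ∈ S ↔ InCode n t (toSeq x) := by
    intro x
    rw [hS, Set.mem_ofPred_eq, InCode]
    refine or_congr ?_ ?_
    · constructor
      · rintro ⟨m, l, hl, hlt, hper, hsnoc⟩
        have hP := (isPeriodic_substr_iff hnt hl hlt x m _ _).1 hper
        have hb := hP.bound
        refine ⟨l, _, hP, ?_⟩
        rw [hper.snoc_iff hl (by omega), substr, modify_eq_update,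
          Function.update_of_ne (by simp only; omega)] at hsnoc
        rw [add_sub_cancel_left, toSeq_of_lt x (show n - 1 < n by omega)]
        convert hsnoc using 2
        simp only; omega
      · rintro ⟨l, a, hP, hne⟩
        obtain ⟨m, rfl⟩ : ∃ m, a = toSeq x (t - 1) + m := ⟨a - toSeq x (t - 1), by abel⟩
        have hb := hP.bound
        have hpos := hP.pos
        have hle := hP.le
        have hper := (isPeriodic_substr_iff hnt hP.pos hP.le x m (by omega) (by omega)).2 hP
        refine ⟨m, l, hP.pos, hP.le, hper, ?_⟩
        rw [hper.snoc_iff hpos (by omega), substr, modify_eq_update,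
          Function.update_of_ne (by simp only; omega)]
        rw [add_sub_cancel_left, toSeq_of_lt x (show n - 1 < n by omega)] at hne
        convert hne using 3
        simp only; omega
    · rw [toSeq_of_lt x (show t - 1 < n by omega), toSeq_of_lt x (show n - 1 < n by omega)]
      refine and_congr_right fun _ => ⟨fun h l a hP => ?_, fun h m l hl hlt hper => ?_⟩
      · refine h (a - toSeq x (t - 1)) l hP.pos hP.le ?_
        rw [isPeriodic_substr_iff hnt hP.pos hP.le]
        rwa [add_sub_cancel]
      · exact h _ _ ((isPeriodic_substr_iff hnt hl hlt x m _ _).1 hper)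
  have hrestrict : ∀ X : ℕ → Fin d, ∀ i < n, X i = toSeq (fun i : Fin n => X i) i :=
    fun X i hi => by rw [toSeq_of_lt _ hi]
  have hrestrictS : ∀ X : ℕ → Fin d, InCode n t X → (fun i : Fin n => X i) ∈ S := fun X hX =>
    (hmem _).2 (hX.congr (by omega) (by omega) (hrestrict X))
  have hrestrictB : ∀ (X : ℕ → Fin d) (v : Vtx d n),
      (fun i : Fin n => X i) ∈ inBall d n t v ↔ InBall n t X (toSeq v) := fun X v => by
    rw [mem_inBall_iff_inBall_toSeq]
    refine exists_congr fun j => and_congr_right fun _ => forall_congr' fun i =>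
      forall_congr' fun h => ?_
    rw [← hrestrict X _ h]
  refine ⟨⟨fun v => ?_, fun u v huv heq => ?_⟩, ?_⟩
  · obtain ⟨X, hX, -, hXv⟩ :=
      exists_inCode_inBall (n := n) (t := t) (by omega) (by omega) (toSeq v) 0
    exact ⟨_, (hrestrictB X v).2 ⟨t, le_rfl, fun i _ => hXv i⟩, hrestrictS X hX⟩
  · obtain ⟨i, hi⟩ := Function.ne_iff.1 huv
    obtain ⟨X, hX, hsep⟩ := exists_separating (V := toSeq u) (V' := toSeq v) hn hnt ht
      ⟨i, i.2, by rwa [toSeq_of_lt u i.2, toSeq_of_lt v i.2]⟩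
    refine hsep ?_
    have := Set.ext_iff.1 heq (fun i : Fin n => X i)
    simpa [hrestrictS X hX, hrestrictB] using this
  · refine ncard_of_excluded_letter ⟨t - 1, by omega⟩ (by omega) fun x => ?_
    obtain ⟨e, he⟩ := exists_excluded_letter (n := n) (t := t) (by omega) (by omega) (toSeq x)
    refine ⟨e, fun c => ?_⟩
    rw [hmem, he _ fun i hi his => ?_, toSeq_of_lt _ (show t - 1 < n by omega),
      Function.update_self]
    rw [toSeq_of_lt _ hi, toSeq_of_lt _ hi,
      Function.update_of_ne (by simpa [Fin.ext_iff] using his)]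

end DeBruijnPaper
end

section
/- Let d ≥ 2, n ≥ 1, and t ≥ 1. Define S = {x ∈ A_d^n : there exists an integer k ≥ 1 with k(t+1) ≤ n such that x_{k(t+1)} ≠ 0 and x_i = 0 for all i < k(t+1)}. Then S ∪ {0ⁿ} is a t-dominating set of the directed de Bruijn graph B⃗(d,n), and its cardinality equals 1 + Σ_{i=1}^{⌊n/(t+1)⌋} (d−1)·d^{n−i(t+1)} = 1 + d^{n−t−1}(d−1)·(1 − d^{−(t+1)⌊n/(t+1)⌋})/(1 − d^{−(t+1)}). -/
/- Common framework: the directed de Bruijn graph B⃗(d,n).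
Vertices are strings of length `n` over the alphabet `A_d = Fin d`,
modelled as functions `Fin n → Fin d` (0-indexed; the paper's 1-indexed
position `i` corresponds to index `i - 1` here). -/

namespace DeBruijnPaper

/-- The length-`n` prefix of `aʲ v`, obtained from `v` by shifting in `j` letters `a` on the left. -/
def shiftIn {d n : ℕ} (a : Fin d) (v : Vtx d n) (j : ℕ) : Vtx d n :=
  fun i => if i.val < j then a else v ⟨i.val - j, by omega⟩

theorem shiftIn_zero {d n : ℕ} (a : Fin d) (v : Vtx d n) : shiftIn a v 0 = v := by
  funext i
  simp [shiftIn]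

theorem adj_shiftIn {d n : ℕ} (a : Fin d) (v : Vtx d n) (j : ℕ) :
    adj d n (shiftIn a v (j + 1)) (shiftIn a v j) := by
  intro i h
  simp [shiftIn]

theorem hasWalk_shiftIn {d n : ℕ} (a : Fin d) (v : Vtx d n) (j : ℕ) :
    hasWalk d n j (shiftIn a v j) v := by
  refine ⟨fun s => shiftIn a v (j - s), by simp, by simp [shiftIn_zero], fun s hs => ?_⟩
  have h : j - s = j - (s + 1) + 1 := by omega
  simp only [h]
  exact adj_shiftIn a v _

theorem shiftIn_mem_inBall {d n t j : ℕ} (a : Fin d) (v : Vtx d n) (hj : j ≤ t) :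
    shiftIn a v j ∈ inBall d n t v :=
  (Nat.sInf_le (hasWalk_shiftIn a v j)).trans hj

/-- The strings whose first letter different from `a` is in (0-indexed) position `p`. -/
def firstNeAt {d : ℕ} (n : ℕ) (a : Fin d) (p : ℕ) : Finset (Vtx d n) :=
  Fintype.piFinset fun i : Fin n =>
    if i.val < p then {a} else if i.val = p then Finset.univ.erase a else Finset.univ

theorem mem_firstNeAt {d n p : ℕ} {a : Fin d} {x : Vtx d n} :
    x ∈ firstNeAt n a p ↔
      (∀ i : Fin n, i.val < p → x i = a) ∧ ∀ i : Fin n, i.val = p → x i ≠ a := by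
  simp only [firstNeAt, Fintype.mem_piFinset]
  constructor
  · intro h
    refine ⟨fun i hi => by simpa [hi] using h i, fun i hi => by simpa [hi] using h i⟩
  · rintro ⟨h₁, h₂⟩ i
    split_ifs with hlt heq
    · simpa using h₁ i hlt
    · simpa using h₂ i heq
    · simp

theorem card_firstNeAt {d n p : ℕ} (a : Fin d) (hp : p < n) :
    (firstNeAt n a p).card = (d - 1) * d ^ (n - (p + 1)) := by
  obtain ⟨m, rfl⟩ : ∃ m, n = p + 1 + m := ⟨n - (p + 1), by omega⟩
  have hcard : ∀ i : Fin (p + 1 + m),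
      (if i.val < p then {a} else if i.val = p then Finset.univ.erase a
        else (Finset.univ : Finset (Fin d))).card =
      (fun i : ℕ => if i < p then 1 else if i = p then d - 1 else d) i.val := by
    intro i
    dsimp only
    split_ifs <;> simp
  rw [firstNeAt, Fintype.card_piFinset, Finset.prod_congr rfl fun i _ => hcard i,
    Fin.prod_univ_eq_prod_range (fun i => if i < p then 1 else if i = p then d - 1 else d),
    Finset.prod_range_add, Finset.prod_range_succ,
    Finset.prod_eq_one fun i hi => if_pos (Finset.mem_range.1 hi),
    Finset.prod_congr rfl (g := fun _ => d) fun i _ => by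
      rw [if_neg (by omega), if_neg (by omega)]]
  simp

theorem disjoint_firstNeAt {d n p q : ℕ} (a : Fin d) (hp : p < n) (hpq : p < q) :
    Disjoint (firstNeAt n a p) (firstNeAt n a q) := by
  rw [Finset.disjoint_left]
  intro x hx hx'
  exact (mem_firstNeAt.1 hx).2 ⟨p, hp⟩ rfl ((mem_firstNeAt.1 hx').1 ⟨p, hp⟩ hpq)

theorem exists_mem_firstNeAt {d n : ℕ} {a : Fin d} {x : Vtx d n} (hx : x ≠ fun _ => a) :
    ∃ p < n, x ∈ firstNeAt n a p := by
  classical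
  have hex : ∃ p, ∃ h : p < n, x ⟨p, h⟩ ≠ a := by
    obtain ⟨i, hi⟩ := Function.ne_iff.1 hx
    exact ⟨i, i.isLt, hi⟩
  obtain ⟨hlt, hne⟩ := Nat.find_spec hex
  refine ⟨Nat.find hex, hlt, mem_firstNeAt.2 ⟨fun i hi => ?_, ?_⟩⟩
  · by_contra hne'
    exact Nat.find_min hex hi ⟨i.isLt, hne'⟩
  · intro i hi
    have : i = ⟨Nat.find hex, hlt⟩ := Fin.ext hi
    rwa [this]

theorem shiftIn_mem_firstNeAt {d n p : ℕ} {a : Fin d} {x : Vtx d n} (hx : x ∈ firstNeAt n a p)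
    (j : ℕ) : shiftIn a x j ∈ firstNeAt n a (p + j) := by
  obtain ⟨h₁, h₂⟩ := mem_firstNeAt.1 hx
  refine mem_firstNeAt.2 ⟨fun i hi => ?_, fun i hi => ?_⟩
  · by_cases hij : i.val < j
    · simp [shiftIn, hij]
    · simpa [shiftIn, hij] using h₁ ⟨i.val - j, by omega⟩ (show i.val - j < p by omega)
  · have hij : ¬ i.val < j := by omega
    simpa [shiftIn, hij] using h₂ ⟨i.val - j, by omega⟩ (show i.val - j = p by omega)

theorem sum_Icc_geometric {b : ℝ} (hb : 1 < b) {n t M : ℕ} (hM : M * (t + 1) ≤ n) :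
    ∑ i ∈ Finset.Icc 1 M, (b - 1) * b ^ (n - i * (t + 1)) =
      b ^ (n - t - 1) * (b - 1) *
        ((1 - b ^ (-(((t : ℤ) + 1) * (M : ℤ)))) / (1 - b ^ (-((t : ℤ) + 1)))) := by
  have hb0 : b ≠ 0 := by positivity
  have hden : 1 - b ^ (-((t : ℤ) + 1)) ≠ 0 := by
    have : b ^ (-((t : ℤ) + 1)) < 1 := zpow_lt_one_of_neg₀ hb (by omega)
    linarith
  induction M with
  | zero => simp
  | succ M ih =>
    have hle : (M + 1) * (t + 1) ≤ n := hM
    have hexp : b ^ (n - (M + 1) * (t + 1)) =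
        b ^ (n - t - 1) * b ^ (-(((t : ℤ) + 1) * (M : ℤ))) := by
      rw [← zpow_natCast, ← zpow_natCast, ← zpow_add₀ hb0]
      congr 1
      have h₁ : t + 1 ≤ n := by nlinarith
      rw [Nat.sub_sub, Nat.cast_sub hle, Nat.cast_sub h₁]
      push_cast
      ring
    have hsucc : b ^ (-(((t : ℤ) + 1) * ((M + 1 : ℕ) : ℤ))) =
        b ^ (-(((t : ℤ) + 1) * (M : ℤ))) * b ^ (-((t : ℤ) + 1)) := by
      rw [← zpow_add₀ hb0]
      congr 1
      push_cast
      ring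
    rw [Finset.sum_Icc_succ_top (by omega), ih (by nlinarith), hexp, hsucc]
    field_simp
    ring

/-- the set `S ∪ {0ⁿ}` is a `t`-dominating set of `B⃗(d,n)` of the stated
cardinality.  (Membership of `x` in `S`: for some `k ≥ 1` with `k(t+1) ≤ n`, the letter
of `x` in (1-indexed) position `k(t+1)` is nonzero and all earlier letters are zero.) -/
theorem stmt8 (d n t : ℕ) (hd : 2 ≤ d) (hn : 1 ≤ n) (ht : 1 ≤ t)
    (S : Set (Vtx d n))
    (hS : S = {x : Vtx d n | ∃ k : ℕ, 1 ≤ k ∧ k * (t + 1) ≤ n ∧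
        (∃ i : Fin n, i.val + 1 = k * (t + 1) ∧ x i ≠ ⟨0, by omega⟩) ∧
        ∀ i : Fin n, i.val + 1 < k * (t + 1) → x i = ⟨0, by omega⟩})
    (z : Vtx d n) (hz : z = fun _ => ⟨0, by omega⟩) :
    IsDomSet d n t (S ∪ {z}) ∧
    (S ∪ {z}).ncard =
      1 + ∑ i ∈ Finset.Icc 1 (n / (t + 1)), (d - 1) * d ^ (n - i * (t + 1)) ∧
    ((S ∪ {z}).ncard : ℝ) =
      1 + (d : ℝ) ^ (n - t - 1) * ((d : ℝ) - 1) *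
        ((1 - (d : ℝ) ^ (-(((t : ℤ) + 1) * ((n / (t + 1) : ℕ) : ℤ)))) /
          (1 - (d : ℝ) ^ (-((t : ℤ) + 1)))) := by
  subst hz
  set a : Fin d := ⟨0, by omega⟩
  have hmem : ∀ x, x ∈ S ↔ ∃ k, 1 ≤ k ∧ k * (t + 1) ≤ n ∧ x ∈ firstNeAt n a (k * (t + 1) - 1) := by
    intro x
    rw [hS]
    refine exists_congr fun k => and_congr_right fun hk => and_congr_right fun hkn => ?_
    have hpos : 1 ≤ k * (t + 1) := Nat.mul_pos hk t.succ_pos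
    rw [mem_firstNeAt]
    constructor
    · rintro ⟨⟨i, hi, hxi⟩, hlt⟩
      refine ⟨fun j hj => hlt j (by omega), fun j hj => ?_⟩
      have : j = i := Fin.ext (by omega)
      rwa [this]
    · rintro ⟨hlt, hne⟩
      exact ⟨⟨⟨k * (t + 1) - 1, by omega⟩, Nat.sub_add_cancel hpos, hne _ rfl⟩,
        fun j hj => hlt j (by omega)⟩
  have hcard : (S ∪ {fun _ => a}).ncard =
      1 + ∑ i ∈ Finset.Icc 1 (n / (t + 1)), (d - 1) * d ^ (n - i * (t + 1)) := by
    have hbound : ∀ k ∈ Finset.Icc 1 (n / (t + 1)), 1 ≤ k * (t + 1) ∧ k * (t + 1) ≤ n := by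
      intro k hk
      rw [Finset.mem_Icc, Nat.le_div_iff_mul_le t.succ_pos] at hk
      exact ⟨Nat.mul_pos hk.1 t.succ_pos, hk.2⟩
    have hSeq : S = ((Finset.Icc 1 (n / (t + 1))).biUnion
        fun k => firstNeAt n a (k * (t + 1) - 1) : Finset (Vtx d n)) := by
      ext x
      simp only [hmem, Finset.coe_biUnion, Set.mem_iUnion, Finset.mem_coe, Finset.mem_Icc,
        Nat.le_div_iff_mul_le t.succ_pos, exists_prop, and_assoc]
    have hz : (fun _ => a) ∉ S := by
      rw [hmem]
      rintro ⟨k, hk, hkn, hx⟩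
      have hpos : 1 ≤ k * (t + 1) := Nat.mul_pos hk t.succ_pos
      exact (mem_firstNeAt.1 hx).2 ⟨k * (t + 1) - 1, by omega⟩ rfl rfl
    rw [Set.union_singleton, Set.ncard_insert_of_notMem hz, add_comm, hSeq, Set.ncard_coe_finset,
      Finset.card_biUnion]
    · refine congrArg _ (Finset.sum_congr rfl fun k hk => ?_)
      obtain ⟨h₁, h₂⟩ := hbound k hk
      rw [card_firstNeAt a (by omega), Nat.sub_add_cancel h₁]
    · intro k hk l hl hkl
      obtain ⟨hk₁, hk₂⟩ := hbound k hk
      obtain ⟨hl₁, hl₂⟩ := hbound l hl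
      rcases hkl.lt_or_gt with h | h
      · have := Nat.mul_lt_mul_of_pos_right h (Nat.add_pos_right t one_pos)
        exact disjoint_firstNeAt a (by omega) (by omega)
      · have := Nat.mul_lt_mul_of_pos_right h (Nat.add_pos_right t one_pos)
        exact (disjoint_firstNeAt a (by omega) (by omega)).symm
  refine ⟨fun v => ?_, hcard, ?_⟩
  · by_cases hv : v = fun _ => a
    · refine ⟨v, ?_, Or.inr hv⟩
      simpa [shiftIn_zero] using shiftIn_mem_inBall a v (Nat.zero_le t)
    obtain ⟨p, -, hpv⟩ := exists_mem_firstNeAt hv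
    set j := t - p % (t + 1)
    refine ⟨shiftIn a v j, shiftIn_mem_inBall a v (Nat.sub_le _ _), ?_⟩
    have hmod : p % (t + 1) < t + 1 := Nat.mod_lt _ t.succ_pos
    have hpj : p + j = (p / (t + 1) + 1) * (t + 1) - 1 := by
      have := Nat.div_add_mod' p (t + 1)
      rw [Nat.succ_mul]
      omega
    have hpj' := shiftIn_mem_firstNeAt hpv j
    rw [hpj] at hpj'
    by_cases hle : (p / (t + 1) + 1) * (t + 1) ≤ n
    · exact Or.inl ((hmem _).2 ⟨_, Nat.succ_pos _, hle, hpj'⟩)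
    · exact Or.inr (funext fun i => (mem_firstNeAt.1 hpj').1 i (by omega))
  · rw [hcard]
    push_cast [Nat.cast_sub (show 1 ≤ d by omega)]
    rw [sum_Icc_geometric (by exact_mod_cast hd) (Nat.div_mul_le_self n (t + 1))]
    push_cast
    rfl


end DeBruijnPaper
end

section
/- Let d ≥ 2, n ≥ 1, and t ≥ 1, and let γ_t(B⃗(d,n)) denote the minimum size of a t-dominating set of the directed de Bruijn graph B⃗(d,n). Then γ_t(B⃗(d,n)) ≥ Σ_{j=1}^{⌊n/(t+1)⌋} (d−1)·d^{n−j(t+1)}, and moreover if n ≡ t (mod t+1) then γ_t(B⃗(d,n)) ≥ 1 + Σ_{j=1}^{⌊n/(t+1)⌋} (d−1)·d^{n−j(t+1)}. -/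
/- Common framework: the directed de Bruijn graph B⃗(d,n).
Vertices are strings of length `n` over the alphabet `A_d = Fin d`,
modelled as functions `Fin n → Fin d` (0-indexed; the paper's 1-indexed
position `i` corresponds to index `i - 1` here). -/

namespace DeBruijnPaper

/-- The minimum size of a `t`-dominating set in `B⃗(d,n)`. -/
noncomputable def gammaT (d n t : ℕ) : ℕ :=
  sInf {k : ℕ | ∃ S : Set (Vtx d n), IsDomSet d n t S ∧ S.ncard = k}

/-- Delete the first letter of `y` and append `a`. -/
def shift (d n : ℕ) (y : Vtx d n) (a : Fin d) : Vtx d n :=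
  fun i => if h : i.val + 1 < n then y ⟨i.val + 1, h⟩ else a

lemma exists_eq_shift_of_adj {d n : ℕ} (hn : 1 ≤ n) {x y : Vtx d n} (h : adj d n x y) :
    ∃ a, y = shift d n x a := by
  refine ⟨y ⟨n - 1, by omega⟩, ?_⟩
  funext i
  unfold shift
  split_ifs with hi
  · exact (h i hi).symm
  · congr 1
    ext
    have := i.isLt
    simp only
    omega

/-- The strings obtained from `s` by `m` successive shifts. -/
def shifts (d n : ℕ) (s : Vtx d n) : ℕ → Finset (Vtx d n)
  | 0 => {s}
  | m + 1 => (shifts d n s m ×ˢ Finset.univ).image fun p => shift d n p.1 p.2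

lemma card_shifts_le (d n : ℕ) (s : Vtx d n) (m : ℕ) : (shifts d n s m).card ≤ d ^ m := by
  induction m with
  | zero => simp [shifts]
  | succ m ih =>
    refine Finset.card_image_le.trans ?_
    rw [Finset.card_product, Finset.card_univ, Fintype.card_fin, pow_succ]
    exact Nat.mul_le_mul_right d ih

lemma mem_shifts_of_hasWalk {d n m : ℕ} (hn : 1 ≤ n) {s v : Vtx d n}
    (h : hasWalk d n m s v) : v ∈ shifts d n s m := by
  induction m generalizing v with
  | zero =>
    obtain ⟨f, rfl, rfl, -⟩ := h
    simp [shifts]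
  | succ m ih =>
    obtain ⟨f, hs, rfl, hf⟩ := h
    obtain ⟨a, ha⟩ := exists_eq_shift_of_adj hn (hf m (Nat.lt_succ_self m))
    rw [ha]
    exact Finset.mem_image.2 ⟨(f m, a), Finset.mem_product.2
      ⟨ih ⟨f, hs, rfl, fun i hi => hf i (hi.trans (Nat.lt_succ_self m))⟩, Finset.mem_univ a⟩, rfl⟩

lemma hasWalk_length (d n : ℕ) (u v : Vtx d n) : hasWalk d n n u v := by
  refine ⟨fun i k => if h : k.val + i < n then u ⟨k.val + i, h⟩ else
    v ⟨(k.val + i) % n, Nat.mod_lt _ (Nat.zero_lt_of_lt k.isLt)⟩, ?_, ?_, ?_⟩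
  · funext k
    simp
  · funext k
    simp [Nat.mod_eq_of_lt k.isLt]
  · intro i _ k _
    simp only [Nat.add_right_comm k 1 i, Nat.add_assoc k i 1]

lemma hasWalk_dirDist (d n : ℕ) (u v : Vtx d n) : hasWalk d n (dirDist d n u v) u v :=
  Nat.sInf_mem (s := {t : ℕ | hasWalk d n t u v}) ⟨n, hasWalk_length d n u v⟩

lemma dirDist_self (d n : ℕ) (u : Vtx d n) : dirDist d n u u = 0 :=
  Nat.sInf_eq_zero.2 (Or.inl ⟨fun _ => u, rfl, rfl, fun i hi => absurd hi (Nat.not_lt_zero i)⟩)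

lemma isDomSet_univ (d n t : ℕ) : IsDomSet d n t Set.univ :=
  fun v => ⟨v, (dirDist_self d n v).trans_le (Nat.zero_le t), Set.mem_univ v⟩

lemma pow_le_ncard_mul_geom_sum {d n t : ℕ} (hn : 1 ≤ n) {S : Set (Vtx d n)}
    (hS : IsDomSet d n t S) : d ^ n ≤ S.ncard * ∑ m ∈ Finset.range (t + 1), d ^ m := by
  classical
  have hcover : (Finset.univ : Finset (Vtx d n)) ⊆
      S.toFinset.biUnion fun s => (Finset.range (t + 1)).biUnion (shifts d n s) := by
    intro v _
    obtain ⟨s, hsv, hs⟩ := hS v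
    simp only [Finset.mem_biUnion, Set.mem_toFinset, Finset.mem_range]
    exact ⟨s, hs, dirDist d n s v, Nat.lt_succ_of_le hsv,
      mem_shifts_of_hasWalk hn (hasWalk_dirDist d n s v)⟩
  calc d ^ n = (Finset.univ : Finset (Vtx d n)).card := by simp
    _ ≤ _ := Finset.card_le_card hcover
    _ ≤ S.toFinset.card * ∑ m ∈ Finset.range (t + 1), d ^ m :=
      Finset.card_biUnion_le_card_mul _ _ _ fun s _ => Finset.card_biUnion_le.trans
        (Finset.sum_le_sum fun m _ => card_shifts_le d n s m)
    _ = _ := by rw [Set.ncard_eq_toFinset_card']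

lemma sum_mul_geom_sum_add {d n t : ℕ} (hd : 1 ≤ d) (q : ℕ) (hq : q * (t + 1) ≤ n) :
    (∑ j ∈ Finset.Icc 1 q, (d - 1) * d ^ (n - j * (t + 1))) *
      (∑ m ∈ Finset.range (t + 1), d ^ m) + d ^ (n - q * (t + 1)) = d ^ n := by
  induction q with
  | zero => simp
  | succ q ih =>
    have hq' : q * (t + 1) + (t + 1) ≤ n := by rwa [Nat.succ_mul] at hq
    have hsub : n - q * (t + 1) = n - (q + 1) * (t + 1) + (t + 1) := by
      rw [Nat.succ_mul]
      omega
    have hgeom : (d - 1) * (∑ m ∈ Finset.range (t + 1), d ^ m) + 1 = d ^ (t + 1) := by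
      obtain ⟨e, rfl⟩ := Nat.exists_eq_add_of_le' hd
      have := geom_sum_mul_add e (t + 1)
      rw [Nat.add_sub_cancel, mul_comm]
      exact this
    rw [Finset.sum_Icc_succ_top (by omega), ← ih (by omega), hsub, pow_add, ← hgeom]
    ring

lemma sum_lt_gammaT {d n t : ℕ} (hd : 1 ≤ d) (hn : 1 ≤ n) :
    ∑ j ∈ Finset.Icc 1 (n / (t + 1)), (d - 1) * d ^ (n - j * (t + 1)) < gammaT d n t := by
  obtain ⟨S, hS, hcard⟩ : gammaT d n t ∈
      {k : ℕ | ∃ S : Set (Vtx d n), IsDomSet d n t S ∧ S.ncard = k} :=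
    Nat.sInf_mem ⟨_, Set.univ, isDomSet_univ d n t, rfl⟩
  rw [← hcard]
  refine lt_of_mul_lt_mul_right (lt_of_lt_of_le ?_ (pow_le_ncard_mul_geom_sum hn hS))
    (Nat.zero_le _)
  rw [← sum_mul_geom_sum_add (t := t) hd (n / (t + 1)) (Nat.div_mul_le_self n (t + 1))]
  exact Nat.lt_add_of_pos_right (pow_pos hd _)

/-- lower bounds on the minimum size of a `t`-dominating set in `B⃗(d,n)`. -/
theorem stmt9 (d n t : ℕ) (hd : 2 ≤ d) (hn : 1 ≤ n) (ht : 1 ≤ t) :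
    (∑ j ∈ Finset.Icc 1 (n / (t + 1)), (d - 1) * d ^ (n - j * (t + 1))) ≤ gammaT d n t ∧
    (n % (t + 1) = t →
      1 + ∑ j ∈ Finset.Icc 1 (n / (t + 1)), (d - 1) * d ^ (n - j * (t + 1)) ≤ gammaT d n t) := by
  have h := sum_lt_gammaT (t := t) (one_le_two.trans hd) hn
  exact ⟨h.le, fun _ => by omega⟩

end DeBruijnPaper
end

section
/- Let d ≥ 2, t ≥ 1, and n ≥ 3 with 2t ≤ n. Then the directed de Bruijn graph B⃗(d,n) is t-identifiable, and the minimum size of a t-identifying code of B⃗(d,n) equals the directed metric dimension of B⃗(d,n), both being equal to d^{n−1}(d−1). -/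
/- Common framework: the directed de Bruijn graph B⃗(d,n).
Vertices are strings of length `n` over the alphabet `A_d = Fin d`,
modelled as functions `Fin n → Fin d` (0-indexed; the paper's 1-indexed
position `i` corresponds to index `i - 1` here). -/

namespace DeBruijnPaper

/-- The `i`-th letter of a word, with the index reduced modulo the length. -/
def letter {d n : ℕ} [NeZero n] (w : Vtx d n) (i : ℕ) : Fin d := w (Fin.ofNat n i)

/-- The word formed by the first `n` terms of a sequence. -/
def ofSeq {d : ℕ} (n : ℕ) (W : ℕ → Fin d) : Vtx d n := fun i => W i

/-- Deleting the first `k` letters of `x` gives a prefix of `y`. -/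
def Shift {d n : ℕ} [NeZero n] (k : ℕ) (x y : Vtx d n) : Prop :=
  ∀ i, i + k < n → letter x (i + k) = letter y i

/-- The two words agree except possibly in the last letter. -/
def AgreeInit {d n : ℕ} [NeZero n] (x y : Vtx d n) : Prop :=
  ∀ i, i + 1 < n → letter x i = letter y i

/-- After deleting `j` letters, `w` has a period `p ≥ 1`, with `j + p ≤ t`. -/
def SuffixPeriodic {d n : ℕ} [NeZero n] (t : ℕ) (w : Vtx d n) : Prop :=
  ∃ j p, 1 ≤ p ∧ j + p ≤ t ∧ ∀ i, j ≤ i → i + p < n → letter w i = letter w (i + p)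

/-- `N` has exactly one member in each class of words sharing all but the last letter. -/
def IsTransversal {d n : ℕ} [NeZero n] (N : Set (Vtx d n)) : Prop :=
  (∀ x ∈ N, ∀ y ∈ N, AgreeInit x y → x = y) ∧ ∀ x, ∃ y ∈ N, AgreeInit x y

theorem IsIdCode.isResolving {d n t : ℕ} {S : Set (Vtx d n)} (h : IsIdCode d n t S) :
    IsResolving d n S := by
  intro u v huv
  by_contra! H
  refine h.2 u v huv (Set.ext fun s => and_congr_left fun hs => ?_)
  simp only [inBall, Set.mem_ofPred_eq, H s hs]

section Words

variable {d n : ℕ} [NeZero n]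

theorem letter_eq (w : Vtx d n) {i : ℕ} (h : i < n) : letter w i = w ⟨i, h⟩ := by
  unfold letter
  congr 1
  exact Fin.ext (Nat.mod_eq_of_lt h)

theorem letter_ofSeq (W : ℕ → Fin d) {i : ℕ} (h : i < n) : letter (ofSeq n W) i = W i := by
  rw [letter_eq _ h, ofSeq]

theorem ext_letter {x y : Vtx d n} (h : ∀ i, i < n → letter x i = letter y i) : x = y := by
  funext ⟨i, hi⟩
  rw [← letter_eq x hi, ← letter_eq y hi, h i hi]

theorem adj_iff (x y : Vtx d n) : adj d n x y ↔ Shift 1 x y := by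
  refine forall_congr' fun i => forall_congr' fun h => ?_
  rw [letter_eq x h, letter_eq y (by omega)]

theorem hasWalk_iff_s11 (k : ℕ) (x y : Vtx d n) : hasWalk d n k x y ↔ Shift k x y := by
  constructor
  · rintro ⟨f, rfl, rfl, hf⟩
    have key : ∀ j, j ≤ k → Shift j (f 0) (f j) := by
      intro j
      induction j with
      | zero => intro _ i _; rfl
      | succ j ih =>
        intro hj i hi
        have h1 := ih (by omega) (i + 1) (by omega)
        have h2 := (adj_iff _ _).1 (hf j (by omega)) i (by omega)
        rw [← h2, ← h1]
        congr 1
        omega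
    exact key k le_rfl
  · intro h
    refine ⟨fun j => ofSeq n fun i => if i + j < n then letter x (i + j)
      else letter y (i - (k - j)), ?_, ?_, ?_⟩
    · refine ext_letter fun i hi => ?_
      simp [letter_ofSeq _ hi, hi]
    · refine ext_letter fun i hi => ?_
      rw [letter_ofSeq _ hi]
      split_ifs with h1
      · exact h i h1
      · simp
    · intro j hj
      rw [adj_iff]
      intro i hi
      rw [letter_ofSeq _ hi, letter_ofSeq _ (by omega)]
      have e1 : i + 1 + j = i + (j + 1) := by omega
      have e2 : i + 1 - (k - j) = i - (k - (j + 1)) := by omega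
      simp only [e1, e2]

theorem dirDist_eq (x y : Vtx d n) : dirDist d n x y = sInf {k | Shift k x y} := by
  simp only [dirDist, hasWalk_iff_s11]

theorem mem_inBall (t : ℕ) (x y : Vtx d n) : x ∈ inBall d n t y ↔ ∃ k ≤ t, Shift k x y := by
  have hne : {k | Shift k x y}.Nonempty := ⟨n, fun i hi => by omega⟩
  simp only [inBall, Set.mem_ofPred_eq, dirDist_eq]
  constructor
  · intro h
    exact ⟨_, h, Nat.sInf_mem hne⟩
  · rintro ⟨k, hk, hs⟩
    exact (Nat.sInf_le hs).trans hk

theorem dirDist_eq_of_agreeInit {s x y : Vtx d n} (h : AgreeInit x y) (hx : s ≠ x) (hy : s ≠ y) :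
    dirDist d n s x = dirDist d n s y := by
  have key : ∀ k, Shift k s x ↔ Shift k s y := by
    intro k
    rcases Nat.eq_zero_or_pos k with rfl | hk
    · exact iff_of_false (fun H => hx (ext_letter fun i hi => H i hi))
        (fun H => hy (ext_letter fun i hi => H i hi))
    · refine forall_congr' fun i => forall_congr' fun hi => ?_
      rw [h i (by omega)]
  simp only [dirDist_eq, key]

theorem ncard_le_of_agreeInit {N : Set (Vtx d n)}
    (h : ∀ x ∈ N, ∀ y ∈ N, AgreeInit x y → x = y) : N.ncard ≤ d ^ (n - 1) := by
  have := Set.ncard_le_ncard_of_injOn (t := (Set.univ : Set (Fin (n - 1) → Fin d)))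
    (fun w (i : Fin (n - 1)) => letter w i) (fun _ _ => Set.mem_univ _)
    (fun x hx y hy hxy => h x hx y hy fun i hi => congrFun hxy ⟨i, by omega⟩) Set.finite_univ
  simpa [Set.ncard_univ, Nat.card_eq_fintype_card] using this

theorem le_ncard_of_agreeInit {N : Set (Vtx d n)} (h : ∀ x, ∃ y ∈ N, AgreeInit x y)
    (hd : 0 < d) : d ^ (n - 1) ≤ N.ncard := by
  have := Set.ncard_le_ncard (s := (Set.univ : Set (Fin (n - 1) → Fin d)))
    (t := (fun w (i : Fin (n - 1)) => letter w i) '' N) (by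
      intro g _
      obtain ⟨y, hy, hgy⟩ := h (ofSeq n fun i => if hi : i < n - 1 then g ⟨i, hi⟩ else ⟨0, hd⟩)
      refine ⟨y, hy, ?_⟩
      funext ⟨i, hi⟩
      have := hgy i (by omega)
      rw [letter_ofSeq _ (by omega)] at this
      simpa [hi] using this.symm) (Set.toFinite _)
  have h2 := this.trans (Set.ncard_image_le (Set.toFinite N))
  simpa [Set.ncard_univ, Nat.card_eq_fintype_card] using h2

theorem ncard_add_ncard_compl_words (S : Set (Vtx d n)) (hd : 0 < d) :
    S.ncard + Sᶜ.ncard = d ^ (n - 1) * (d - 1) + d ^ (n - 1) := by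
  have hn : n = (n - 1) + 1 := by have := NeZero.pos n; omega
  rw [Set.ncard_add_ncard_compl S, Nat.card_eq_fintype_card, Fintype.card_fun, Fintype.card_fin,
    Fintype.card_fin]
  obtain ⟨d, rfl⟩ := Nat.exists_eq_add_of_lt hd
  conv_lhs => rw [hn]
  rw [pow_succ]
  simp
  ring

theorem IsResolving.le_ncard {S : Set (Vtx d n)} (h : IsResolving d n S) (hd : 0 < d) :
    d ^ (n - 1) * (d - 1) ≤ S.ncard := by
  have h1 : Sᶜ.ncard ≤ d ^ (n - 1) := by
    refine ncard_le_of_agreeInit fun x hx y hy hxy => ?_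
    by_contra hne
    obtain ⟨s, hs, hdist⟩ := h x y hne
    exact hdist (dirDist_eq_of_agreeInit hxy (fun e => hx (e ▸ hs)) (fun e => hy (e ▸ hs)))
  have := ncard_add_ncard_compl_words S hd
  omega

theorem IsTransversal.ncard_compl {N : Set (Vtx d n)} (h : IsTransversal N) (hd : 0 < d) :
    Nᶜ.ncard = d ^ (n - 1) * (d - 1) := by
  have h1 := ncard_le_of_agreeInit h.1
  have h2 := le_ncard_of_agreeInit h.2 hd
  have := ncard_add_ncard_compl_words N hd
  omega

end Words

section Periods

theorem eq_mod_of_period {α : Type*} {s : ℕ → α} {p L : ℕ} (hp : 0 < p)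
    (h : ∀ i, i + p < L → s i = s (i + p)) (i : ℕ) (hi : i < L) : s i = s (i % p) := by
  induction i using Nat.strong_induction_on with
  | _ i ih =>
    rcases lt_or_ge i p with hip | hip
    · rw [Nat.mod_eq_of_lt hip]
    · have h1 := h (i - p) (by omega)
      rw [Nat.sub_add_cancel hip] at h1
      rw [← h1, ih (i - p) (by omega) (by omega), Nat.mod_eq_sub_mod hip]

/-- The Fine–Wilf periodicity theorem. -/
theorem eq_of_modEq_gcd_of_periods {α : Type*} (s : ℕ → α) (p q L : ℕ) (hp : 0 < p) (hq : 0 < q)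
    (hL : p + q ≤ L + p.gcd q) (h1 : ∀ i, i + p < L → s i = s (i + p))
    (h2 : ∀ i, i + q < L → s i = s (i + q)) (i k : ℕ) (hi : i < L) (hk : k < L)
    (hik : i % p.gcd q = k % p.gcd q) : s i = s k := by
  induction hm : p + q using Nat.strong_induction_on generalizing p q L i k with
  | _ m ih =>
    wlog hpq : p ≤ q generalizing p q
    · exact this q p hq hp (by rw [Nat.gcd_comm]; omega) h2 h1 (by rw [Nat.gcd_comm]; exact hik)
        (by omega) (by omega)
    rcases hpq.eq_or_lt with rfl | hlt
    · rw [Nat.gcd_self] at hik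
      rw [eq_mod_of_period hp h1 i hi, eq_mod_of_period hp h1 k hk, hik]
    · have hg : p.gcd (q - p) = p.gcd q := Nat.gcd_sub_self_right hpq
      have hgle : p.gcd q ≤ q - p := hg ▸ Nat.gcd_le_right p (by omega)
      have hred : ∀ i, i < L → ∃ i', i' < L - p ∧ i' % p.gcd q = i % p.gcd q ∧ s i' = s i := by
        intro i hi
        rcases lt_or_ge i (L - p) with h | h
        · exact ⟨i, h, rfl, rfl⟩
        · refine ⟨i - p, by omega, ?_, ?_⟩
          · obtain ⟨c, hc⟩ := Nat.gcd_dvd_left p q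
            have : i = (i - p) + p.gcd q * c := by omega
            conv_rhs => rw [this, Nat.add_mul_mod_self_left]
          · rw [h1 (i - p) (by omega), Nat.sub_add_cancel (by omega)]
      obtain ⟨i', hi', hi1, hi2⟩ := hred i hi
      obtain ⟨k', hk', hk1, hk2⟩ := hred k hk
      rw [← hi2, ← hk2]
      refine ih (p + (q - p)) (by omega) p (q - p) (L - p) hp (by omega) (by rw [hg]; omega)
        (fun i hi => h1 i (by omega)) (fun i hi => ?_) i' k' hi' hk'
        (by rw [hg, hi1, hk1, hik]) rfl
      rw [h2 i (by omega), h1 (i + (q - p)) (by omega)]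
      congr 1
      omega

theorem eq_last_of_suffix_periods {α : Type*} {x y : ℕ → α} {N t j p j' p' : ℕ}
    (hxy : ∀ i, i < N → x i = y i) (hN : 2 * t ≤ N + 1) (hp : 1 ≤ p) (hp' : 1 ≤ p')
    (hj : j + p ≤ t) (hj' : j' + p' ≤ t) (hx : ∀ i, j ≤ i → i + p ≤ N → x i = x (i + p))
    (hy : ∀ i, j' ≤ i → i + p' ≤ N → y i = y (i + p')) : x N = y N := by
  wlog hjj : j ≤ j' generalizing x y j p j' p'
  · exact (this (fun i hi => (hxy i hi).symm) hp' hp hj' hj hy hx (by omega)).symm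
  have ex : x N = x (N - p) := by
    rw [hx (N - p) (by omega) (by omega), Nat.sub_add_cancel (by omega)]
  have ey : y N = x (N - p') := by
    rw [hxy _ (by omega), hy (N - p') (by omega) (by omega), Nat.sub_add_cancel (by omega)]
  have hx' : ∀ i, j' ≤ i → i + p' < N → x i = x (i + p') := by
    intro i h1 h2
    rw [hxy _ (by omega), hxy _ (by omega), hy i h1 (by omega)]
  rw [ex, ey]
  rcases le_or_gt (p + p' + j') N with h | h
  · have h1 := hx' (N - p - p') (by omega) (by omega)
    have h2 := hx (N - p - p') (by omega) (by omega)
    rw [show N - p - p' + p' = N - p by omega] at h1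
    rw [show N - p - p' + p = N - p' by omega] at h2
    rw [← h1, ← h2]
  · have key := eq_of_modEq_gcd_of_periods (fun i => x (j' + i)) p p' (N - j') hp hp'
      (by have := Nat.gcd_pos_of_pos_left p' hp; omega)
      (fun i hi => by simpa [add_assoc] using hx (j' + i) (by omega) (by omega))
      (fun i hi => by simpa [add_assoc] using hx' (j' + i) (by omega) (by omega))
      (N - p - j') (N - p' - j') (by omega) (by omega) (by
        obtain ⟨a, ha⟩ := Nat.gcd_dvd_left p p'
        obtain ⟨b, hb⟩ := Nat.gcd_dvd_right p p'
        have hd : p.gcd p' ∣ p - p' := Nat.dvd_sub (Nat.gcd_dvd_left _ _) (Nat.gcd_dvd_right _ _)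
        obtain ⟨c, hc⟩ := hd
        rw [show N - p' - j' = (N - p - j') + p.gcd p' * c by omega, Nat.add_mul_mod_self_left])
    rw [show j' + (N - p - j') = N - p by omega, show j' + (N - p' - j') = N - p' by omega] at key
    exact key

end Periods

section Codes

variable {d n t : ℕ} [NeZero n]

/-- The word of length `n` obtained from `v` by prepending `j` letters, `b c c ⋯ c`. -/
def prepend (b c : Fin d) (j : ℕ) (v : Vtx d n) : Vtx d n :=
  ofSeq n fun i => if i < j then (if i = 0 then b else c) else letter v (i - j)

theorem letter_prepend (b c : Fin d) (j : ℕ) (v : Vtx d n) {i : ℕ} (h : i < n) :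
    letter (prepend b c j v) i =
      if i < j then (if i = 0 then b else c) else letter v (i - j) :=
  letter_ofSeq _ h

theorem letter_prepend_add (b c : Fin d) (j : ℕ) (v : Vtx d n) {i : ℕ} (h : i + j < n) :
    letter (prepend b c j v) (i + j) = letter v i := by
  rw [letter_prepend _ _ _ _ h, if_neg (by omega), Nat.add_sub_cancel]

theorem letter_prepend_zero (b c : Fin d) {j : ℕ} (v : Vtx d n) (hj : 0 < j) :
    letter (prepend b c j v) 0 = b := by
  rw [letter_prepend _ _ _ _ (NeZero.pos n), if_pos hj, if_pos rfl]

theorem letter_prepend_of_lt (b c : Fin d) {j : ℕ} (v : Vtx d n) {i : ℕ} (hi : 1 ≤ i)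
    (hij : i < j) (hj : j ≤ n) : letter (prepend b c j v) i = c := by
  rw [letter_prepend _ _ _ _ (by omega), if_pos hij, if_neg (by omega)]

theorem letter_prepend_self (c : Fin d) {j : ℕ} (v : Vtx d n) {i : ℕ}
    (hij : i < j) (hj : j ≤ n) : letter (prepend c c j v) i = c := by
  rw [letter_prepend _ _ _ _ (by omega), if_pos hij, ite_self]

theorem prepend_mem_inBall (b c : Fin d) {j : ℕ} (hj : j ≤ t) (v : Vtx d n) :
    prepend b c j v ∈ inBall d n t v :=
  (mem_inBall _ _ _).2 ⟨j, hj, fun _ hi => letter_prepend_add b c j v hi⟩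

theorem SuffixPeriodic.eq_of_agreeInit {x y : Vtx d n} (hnt : 2 * t ≤ n)
    (hx : SuffixPeriodic t x) (hy : SuffixPeriodic t y) (h : AgreeInit x y) : x = y := by
  obtain ⟨j, p, hp, hj, hx⟩ := hx
  obtain ⟨j', p', hp', hj', hy⟩ := hy
  have hn := NeZero.pos n
  have key := eq_last_of_suffix_periods (x := letter x) (y := letter y) (N := n - 1)
    (fun i hi => h i (by omega)) (by omega) hp hp' hj hj'
    (fun i h1 h2 => hx i h1 (by omega)) (fun i h1 h2 => hy i h1 (by omega))
  refine ext_letter fun i hi => ?_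
  rcases Nat.lt_or_ge (i + 1) n with h1 | h1
  · exact h i h1
  · rwa [show i = n - 1 by omega]

theorem IsTransversal.eq_or_not_mem {N : Set (Vtx d n)} (hN : IsTransversal N) {x y : Vtx d n}
    (h : AgreeInit x y) (hne : x ≠ y) : x ∉ N ∨ y ∉ N := by
  by_contra! H
  exact hne (hN.1 x H.1 y H.2 h)

theorem prepend_not_mem_inBall {N : Set (Vtx d n)} (hper : ∀ w, SuffixPeriodic t w → w ∈ N)
    {u v : Vtx d n} {j m : ℕ} (hjm : m + j + 1 = n)
    (heq : ∀ i < m, letter u i = letter v i) (hne : letter u m ≠ letter v m) {c : Fin d}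
    (hc : c ≠ letter u 0) (hw : prepend c c j v ∉ N) : prepend c c j v ∉ inBall d n t u := by
  rw [mem_inBall]
  rintro ⟨k, hk, hs⟩
  rcases lt_trichotomy k j with h | rfl | h
  · have := hs 0 (by omega)
    rw [Nat.zero_add, letter_prepend_self c v h (by omega)] at this
    exact hc this
  · have := hs m (by omega)
    rw [letter_prepend_add _ _ _ _ (by omega)] at this
    exact hne this.symm
  · refine hw (hper _ ⟨j, k - j, by omega, by omega, fun i hi hin => ?_⟩)
    have h1 := hs (i - j) (by omega)
    have h2 := letter_prepend_add c c j v (i := i - j) (by omega)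
    rw [Nat.sub_add_cancel hi] at h2
    rw [show i - j + k = i + (k - j) by omega, heq _ (by omega)] at h1
    rw [h1, h2]

theorem inBall_inter_ne_of_agree {N : Set (Vtx d n)} (hN : IsTransversal N)
    (hper : ∀ w, SuffixPeriodic t w → w ∈ N) (hd : 2 ≤ d) {u v : Vtx d n} {m : ℕ} (h0 : 0 < m)
    (hm : m < n) (hmt : n ≤ m + t + 1) (heq : ∀ i < m, letter u i = letter v i)
    (hne : letter u m ≠ letter v m) : inBall d n t u ∩ Nᶜ ≠ inBall d n t v ∩ Nᶜ := by
  have := Fin.nontrivial_iff_two_le.2 hd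
  obtain ⟨c, hc⟩ := exists_ne (letter u 0)
  obtain ⟨j, hj⟩ : ∃ j, m + j + 1 = n := ⟨n - 1 - m, by omega⟩
  intro H
  have hag : AgreeInit (prepend c c j u) (prepend c c j v) := by
    intro i hi
    rw [letter_prepend _ _ _ _ (by omega), letter_prepend _ _ _ _ (by omega)]
    split_ifs
    · rfl
    · rfl
    · exact heq _ (by omega)
  rcases hN.eq_or_not_mem hag (fun e => hne (by
      rw [← letter_prepend_add c c j u (i := m) (by omega), e,
        letter_prepend_add _ _ _ _ (by omega)])) with h | h
  · refine prepend_not_mem_inBall hper hj (fun i hi => (heq i hi).symm) hne.symm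
      (heq 0 h0 ▸ hc) h ?_
    exact (H ▸ ⟨prepend_mem_inBall c c (by omega) u, h⟩ :
      prepend c c j u ∈ inBall d n t v ∩ Nᶜ).1
  · refine prepend_not_mem_inBall hper hj heq hne hc h ?_
    exact (H ▸ ⟨prepend_mem_inBall c c (by omega) v, h⟩ :
      prepend c c j v ∈ inBall d n t u ∩ Nᶜ).1

theorem isIdCode_compl {N : Set (Vtx d n)} (hN : IsTransversal N)
    (hper : ∀ w, SuffixPeriodic t w → w ∈ N) (hd : 2 ≤ d) (hnt : t + 1 < n)
    (hdom : ∀ v, ∃ w ∉ N, w ∈ inBall d n t v)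
    (hfar : ∀ u v, (∃ m, m + t < n ∧ letter u m ≠ letter v m) →
      (∀ w ∉ N, w ∈ inBall d n t u ↔ w ∈ inBall d n t v) → False) :
    IsIdCode d n t Nᶜ := by
  constructor
  · intro v
    obtain ⟨w, hw, hwv⟩ := hdom v
    exact ⟨w, hwv, hw⟩
  · intro u v huv H
    by_cases hm : ∃ m, m + t < n ∧ letter u m ≠ letter v m
    · refine hfar u v hm fun w hw => ?_
      have := Set.ext_iff.1 H w
      simpa [hw] using this
    · push Not at hm
      have hex : ∃ m, m < n ∧ letter u m ≠ letter v m := by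
        by_contra! h
        exact huv (ext_letter h)
      classical
      have h1 := Nat.find_spec hex
      have h2 : n ≤ Nat.find hex + t := by
        by_contra! h
        exact h1.2 (hm _ h)
      refine inBall_inter_ne_of_agree hN hper hd (by omega) h1.1 (by omega)
        (fun i hi => ?_) h1.2 H
      by_contra h
      exact Nat.find_min hex hi ⟨by omega, h⟩

/-- If the balls around `u` and `v` contain the same words outside `N`, then a word outside `N` at
distance `t` from `v` is at distance less than `t` from `u`. -/
theorem exists_shift_lt {N : Set (Vtx d n)} {u v : Vtx d n}
    (hm : ∃ m, m + t < n ∧ letter u m ≠ letter v m)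
    (hsub : ∀ w ∉ N, w ∈ inBall d n t v → w ∈ inBall d n t u) {b c : Fin d}
    (hw : prepend b c t v ∉ N) : ∃ k < t, Shift k (prepend b c t v) u := by
  obtain ⟨k, hk, hs⟩ := (mem_inBall _ _ _).1 (hsub _ hw (prepend_mem_inBall b c le_rfl v))
  rcases hk.lt_or_eq with h | rfl
  · exact ⟨k, h, hs⟩
  · obtain ⟨m, hm, hne⟩ := hm
    have := hs m hm
    rw [letter_prepend_add _ _ _ _ hm] at this
    exact absurd this.symm hne

theorem exists_mem_isIdCode_one (hd : 2 ≤ d) (hn : 3 ≤ n) :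
    ∃ N : Set (Vtx d n), IsTransversal N ∧ IsIdCode d n 1 Nᶜ := by
  have := Fin.nontrivial_iff_two_le.2 hd
  set N : Set (Vtx d n) :=
    {w | letter w (n - 1) = Equiv.swap (letter w 1) (letter w (n - 2)) (letter w 0)}
  have hmem : ∀ w, w ∈ N ↔
    letter w (n - 1) = Equiv.swap (letter w 1) (letter w (n - 2)) (letter w 0) := fun w => Iff.rfl
  have hN : IsTransversal N := by
    constructor
    · intro x hx y hy h
      rw [hmem] at hx hy
      rw [h 0 (by omega), h 1 (by omega), h (n - 2) (by omega), ← hy] at hx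
      refine ext_letter fun i hi => ?_
      rcases Nat.lt_or_ge (i + 1) n with h1 | h1
      · exact h i h1
      · rwa [show i = n - 1 by omega]
    · intro x
      refine ⟨ofSeq n fun i => if i = n - 1 then
        Equiv.swap (letter x 1) (letter x (n - 2)) (letter x 0) else letter x i, ?_, ?_⟩
      · rw [hmem]
        repeat rw [letter_ofSeq _ (by omega)]
        rw [if_pos rfl, if_neg (by omega), if_neg (by omega), if_neg (by omega)]
      · intro i hi
        rw [letter_ofSeq _ (by omega), if_neg (by omega)]
  have hpre : ∀ v : Vtx d n, ∃ a, prepend a a 1 v ∉ N := by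
    intro v
    obtain ⟨a, ha⟩ := exists_ne
      (Equiv.swap (letter v 0) (letter v (n - 3)) (letter v (n - 2)))
    refine ⟨a, fun h => ha ?_⟩
    rw [hmem] at h
    have e1 := letter_prepend_add a a 1 v (i := n - 2) (by omega)
    have e2 := letter_prepend_add a a 1 v (i := n - 3) (by omega)
    have e3 := letter_prepend_add a a 1 v (i := 0) (by omega)
    rw [show n - 2 + 1 = n - 1 by omega] at e1
    rw [show n - 3 + 1 = n - 2 by omega] at e2
    rw [zero_add] at e3
    rw [e1, e2, e3, letter_prepend_zero a a v one_pos] at h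
    rw [h, Equiv.swap_apply_self]
  refine ⟨N, hN, isIdCode_compl hN ?_ hd (by omega) ?_ ?_⟩
  · rintro w ⟨j, p, hp, hj, hw⟩
    obtain rfl : j = 0 := by omega
    obtain rfl : p = 1 := by omega
    have hconst : ∀ i, i < n → letter w i = letter w 0 := by
      intro i
      induction i with
      | zero => intro _; rfl
      | succ i ih => intro hi; rw [← hw i (by omega) hi, ih (by omega)]
    rw [hmem, hconst _ (by omega), hconst 1 (by omega), hconst (n - 2) (by omega)]
    simp
  · intro v
    obtain ⟨a, ha⟩ := hpre v
    exact ⟨_, ha, prepend_mem_inBall a a le_rfl v⟩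
  · intro u v hm hsub
    have key : ∀ u v : Vtx d n, (∃ m, m + 1 < n ∧ letter u m ≠ letter v m) →
        (∀ w ∉ N, w ∈ inBall d n 1 v → w ∈ inBall d n 1 u) →
        u ∉ N ∧ ∀ i, i + 1 < n → letter u (i + 1) = letter v i := by
      intro u v hm hsub
      obtain ⟨a, ha⟩ := hpre v
      obtain ⟨k, hk, hs⟩ := exists_shift_lt hm hsub ha
      obtain rfl : k = 0 := by omega
      have hu : prepend a a 1 v = u := ext_letter fun i hi => hs i hi
      subst hu
      exact ⟨ha, fun i hi => letter_prepend_add a a 1 v hi⟩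
    obtain ⟨hu, huv⟩ := key u v hm fun w hw => (hsub w hw).2
    obtain ⟨-, hvu⟩ := key v u (by simpa only [ne_comm] using hm) fun w hw => (hsub w hw).1
    have hpar : ∀ k, (2 * k < n → letter u (2 * k) = letter u 0) ∧
        (2 * k + 1 < n → letter u (2 * k + 1) = letter u 1) := by
      intro k
      induction k with
      | zero => simp
      | succ k ih =>
        refine ⟨fun h => ?_, fun h => ?_⟩
        · rw [← ih.1 (by omega), ← hvu (2 * k) (by omega)]
          exact huv (2 * k + 1) (by omega)
        · rw [← ih.2 (by omega), ← hvu (2 * k + 1) (by omega)]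
          exact huv (2 * k + 1 + 1) (by omega)
    refine hu ((hmem u).2 ?_)
    obtain ⟨k, hk⟩ := Nat.even_or_odd' n
    rcases hk with hk | hk
    · have h1 := (hpar (k - 1)).1 (by omega)
      have h2 := (hpar (k - 1)).2 (by omega)
      rw [show 2 * (k - 1) = n - 2 by omega] at h1
      rw [show 2 * (k - 1) + 1 = n - 1 by omega] at h2
      rw [h1, h2, Equiv.swap_apply_right]
    · have h1 := (hpar k).1 (by omega)
      have h2 := (hpar (k - 1)).2 (by omega)
      rw [show 2 * k = n - 1 by omega] at h1
      rw [show 2 * (k - 1) + 1 = n - 2 by omega] at h2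
      rw [h1, h2, Equiv.swap_self, Equiv.refl_apply]

theorem SuffixPeriodic.of_prepend {b c : Fin d} {v : Vtx d n} (ht : 1 ≤ t) (hnt : 2 * t ≤ n)
    (h : SuffixPeriodic t (prepend b c t v)) :
    (∀ i, i + t < n → letter v i = c) ∨ b ≠ c ∧ letter v 0 = b := by
  obtain ⟨j, p, hp, hj, hw⟩ := h
  by_cases hcase : p < t ∨ b = c
  · left
    intro i
    induction i using Nat.strong_induction_on with
    | _ i ih =>
      intro hi
      have h1 := hw (i + t - p) (by omega) (by omega)
      rw [Nat.sub_add_cancel (by omega), letter_prepend_add _ _ _ _ hi] at h1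
      rw [← h1]
      rcases Nat.lt_or_ge i p with hip | hip
      · rcases hcase with hcase | rfl
        · exact letter_prepend_of_lt _ _ _ (by omega) (by omega) (by omega)
        · exact letter_prepend_self _ _ (by omega) (by omega)
      · rw [show i + t - p = i - p + t by omega, letter_prepend_add _ _ _ _ (by omega)]
        exact ih _ (by omega) (by omega)
  · push Not at hcase
    right
    obtain rfl : p = t := by omega
    obtain rfl : j = 0 := by omega
    have h1 := hw 0 le_rfl (by omega)
    rw [letter_prepend_zero _ _ _ (by omega), letter_prepend_add _ _ _ _ (by omega)] at h1
    exact ⟨hcase.2, h1.symm⟩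

/-- The words that are suffix periodic, together with the words with equal first and last letters
that do not agree with a suffix periodic word off the last letter. -/
def periodicTransversal (d n t : ℕ) [NeZero n] : Set (Vtx d n) :=
  {w | SuffixPeriodic t w ∨
    (∀ x, AgreeInit w x → ¬ SuffixPeriodic t x) ∧ letter w (n - 1) = letter w 0}

theorem isTransversal_periodicTransversal (hn : 2 ≤ n) (hnt : 2 * t ≤ n) :
    IsTransversal (periodicTransversal d n t) := by
  constructor
  · rintro x (hx | ⟨hx, hx'⟩) y (hy | ⟨hy, hy'⟩) h
    · exact hx.eq_of_agreeInit hnt hy h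
    · exact absurd hx (hy x fun i hi => (h i hi).symm)
    · exact absurd hy (hx y h)
    · refine ext_letter fun i hi => ?_
      rcases Nat.lt_or_ge (i + 1) n with h1 | h1
      · exact h i h1
      · rw [show i = n - 1 by omega, hx', hy', h 0 (by omega)]
  · intro x
    by_cases h : ∃ y, AgreeInit x y ∧ SuffixPeriodic t y
    · obtain ⟨y, h1, h2⟩ := h
      exact ⟨y, Or.inl h2, h1⟩
    · push Not at h
      have hag : AgreeInit x (ofSeq n fun i => if i = n - 1 then letter x 0 else letter x i) := by
        intro i hi
        rw [letter_ofSeq _ (by omega), if_neg (by omega)]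
      refine ⟨_, Or.inr ⟨fun z hz => h z fun i hi => (hag i hi).trans (hz i hi), ?_⟩, hag⟩
      rw [letter_ofSeq _ (by omega), letter_ofSeq _ (by omega), if_pos rfl, if_neg (by omega)]

theorem suffixPeriodic_of_mem_prepend {b c : Fin d} {v : Vtx d n} (ht : 1 ≤ t) (hnt : 2 * t ≤ n)
    (hb : b ≠ letter v (n - 1 - t)) (h : prepend b c t v ∈ periodicTransversal d n t) :
    SuffixPeriodic t (prepend b c t v) := by
  rcases h with h | ⟨-, h⟩
  · exact h
  · have h1 := letter_prepend_add b c t v (i := n - 1 - t) (by omega)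
    rw [show n - 1 - t + t = n - 1 by omega, h, letter_prepend_zero _ _ _ (by omega)] at h1
    exact absurd h1 hb

theorem prepend_self_not_mem {c : Fin d} {v : Vtx d n} (ht : 1 ≤ t) (hnt : 2 * t ≤ n)
    (hc : c ≠ letter v (n - 1 - t)) : prepend c c t v ∉ periodicTransversal d n t := by
  intro h
  rcases (suffixPeriodic_of_mem_prepend ht hnt hc h).of_prepend ht hnt with h1 | h1
  · exact hc (h1 _ (by omega)).symm
  · exact h1.1 rfl

theorem exists_run {u v : Vtx d n} (ht : 1 ≤ t) (hnt : 2 * t ≤ n)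
    (hm : ∃ m, m + t < n ∧ letter u m ≠ letter v m)
    (hsub : ∀ w ∉ periodicTransversal d n t, w ∈ inBall d n t v → w ∈ inBall d n t u) {c : Fin d}
    (hc : c ≠ letter v (n - 1 - t)) :
    ∃ r, 1 ≤ r ∧ r ≤ t ∧ (∀ i < r, letter u i = c) ∧
      ∀ i, i + t < n → letter u (i + r) = letter v i := by
  obtain ⟨k, hk, hs⟩ := exists_shift_lt hm hsub (prepend_self_not_mem ht hnt hc)
  refine ⟨t - k, by omega, by omega, fun i hi => ?_, fun i hi => ?_⟩
  · rw [← hs i (by omega), letter_prepend_self _ _ (by omega) (by omega)]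
  · rw [← hs _ (by omega), show i + (t - k) + k = i + t by omega, letter_prepend_add _ _ _ _ hi]

theorem letter_eq_of_runs {u v : Vtx d n} (ht : 2 ≤ t) (hnt : 2 * t ≤ n)
    (hm : ∃ m, m + t < n ∧ letter u m ≠ letter v m)
    (hsub : ∀ w ∉ periodicTransversal d n t, w ∈ inBall d n t v → w ∈ inBall d n t u)
    {c e : Fin d} {r s : ℕ} (hce : c ≠ e) (hc : c ≠ letter v (n - 1 - t))
    (he : e ≠ letter u (n - 1 - t)) (hr : 1 ≤ r) (hs : 1 ≤ s) (hst : s ≤ t)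
    (hu0 : ∀ i < r, letter u i = c) (hu1 : ∀ i, i + t < n → letter u (i + r) = letter v i)
    (hv0 : ∀ i < s, letter v i = e) (hv1 : ∀ i, i + t < n → letter v (i + s) = letter u i) :
    ∀ i, i + t < n → letter v i = e := by
  by_cases hmem : prepend c e t v ∈ periodicTransversal d n t
  · rcases (suffixPeriodic_of_mem_prepend (by omega) hnt hc hmem).of_prepend (by omega) hnt
      with h | ⟨-, h⟩
    · exact h
    · exact absurd (h.symm.trans (hv0 0 (by omega))) hce
  · exfalso
    obtain ⟨k, hk, hs'⟩ := exists_shift_lt hm hsub hmem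
    rcases Nat.eq_zero_or_pos k with rfl | hk0
    · have hmid : ∀ i, 1 ≤ i → i < t → letter u i = e := fun i h1 h2 => by
        rw [← hs' i (by omega), Nat.add_zero, letter_prepend_of_lt _ _ _ h1 h2 (by omega)]
      have htail : ∀ i, i + t < n → letter u (i + t) = letter v i := fun i hi => by
        rw [← hs' (i + t) (by omega), Nat.add_zero, letter_prepend_add _ _ _ _ hi]
      obtain rfl : r = 1 := by
        by_contra hr1
        exact hce ((hu0 1 (by omega)).symm.trans (hmid 1 le_rfl (by omega)))
      rcases Nat.lt_or_ge (s + t) n with h | h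
      · have h1 := hu1 s h
        have h2 := hv1 0 (by omega)
        rw [Nat.zero_add] at h2
        rw [h2, hu0 0 one_pos] at h1
        rcases Nat.lt_or_ge (s + 1) t with h3 | h3
        · exact hce (h1.symm.trans (hmid _ (by omega) h3))
        · have h4 := htail (s + 1 - t) (by omega)
          rw [Nat.sub_add_cancel h3, h1, hv0 _ (by omega)] at h4
          exact hce h4
      · rw [hmid _ (by omega) (by omega)] at he
        exact he rfl
    · have h1 := hs' 0 (by omega)
      rw [Nat.zero_add, letter_prepend_of_lt _ _ _ hk0 hk (by omega), hu0 0 (by omega)] at h1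
      exact hce h1.symm

theorem isIdCode_periodicTransversal_compl (hd : 2 ≤ d) (ht : 2 ≤ t) (hnt : 2 * t ≤ n) :
    IsIdCode d n t (periodicTransversal d n t)ᶜ := by
  have := Fin.nontrivial_iff_two_le.2 hd
  have hN := isTransversal_periodicTransversal (d := d) (by omega : 2 ≤ n) hnt
  refine isIdCode_compl hN (fun w => Or.inl) hd (by omega) ?_ ?_
  · intro v
    obtain ⟨c, hc⟩ := exists_ne (letter v (n - 1 - t))
    exact ⟨_, prepend_self_not_mem (by omega) hnt hc, prepend_mem_inBall c c le_rfl v⟩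
  · intro u v hm hsub
    have hm' : ∃ m, m + t < n ∧ letter v m ≠ letter u m := by simpa only [ne_comm] using hm
    have hvu := fun w hw => (hsub w hw).2
    have huv := fun w hw => (hsub w hw).1
    obtain ⟨c, hc⟩ := exists_ne (letter v (n - 1 - t))
    obtain ⟨e, he⟩ := exists_ne (letter u (n - 1 - t))
    obtain ⟨r, hr, hrt, hu0, hu1⟩ := exists_run (by omega) hnt hm hvu hc
    obtain ⟨s, hs, hst, hv0, hv1⟩ := exists_run (by omega) hnt hm' huv he
    have hce : c ≠ e := by
      rintro rfl
      have key : ∀ i, i + t < n → letter u i = c ∧ letter v i = c := by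
        intro i
        induction i using Nat.strong_induction_on with
        | _ i ih =>
          intro hi
          constructor
          · rcases Nat.lt_or_ge i r with h | h
            · exact hu0 i h
            · rw [← (ih (i - r) (by omega) (by omega)).2, ← hu1 _ (by omega),
                Nat.sub_add_cancel h]
          · rcases Nat.lt_or_ge i s with h | h
            · exact hv0 i h
            · rw [← (ih (i - s) (by omega) (by omega)).1, ← hv1 _ (by omega),
                Nat.sub_add_cancel h]
      exact hc (key _ (by omega)).2.symm
    have hve := letter_eq_of_runs ht hnt hm hvu hce hc he hr hs hst hu0 hu1 hv0 hv1
    have hv_s := hv1 0 (by omega)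
    rw [Nat.zero_add, hu0 0 (by omega)] at hv_s
    have hsn : n ≤ s + t := by
      by_contra! h
      exact hce (hv_s.symm.trans (hve s h))
    obtain rfl : s = t := by omega
    have hconst : SuffixPeriodic s (ofSeq n fun _ => e) :=
      ⟨0, 1, le_rfl, by omega, fun i _ hi => by
        rw [letter_ofSeq _ (by omega), letter_ofSeq _ (by omega)]⟩
    have hword : (ofSeq n fun i => if i = n - 1 then c else e) ∉ periodicTransversal d n s := by
      intro h
      have := hN.1 _ h _ (Or.inl hconst) fun i hi => by
        rw [letter_ofSeq _ (by omega), letter_ofSeq _ (by omega), if_neg (by omega)]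
      have := congrArg (fun w => letter w (n - 1)) this
      rw [letter_ofSeq _ (by omega), letter_ofSeq _ (by omega), if_pos rfl] at this
      exact hce this
    have hmem := hvu _ hword ((mem_inBall _ _ _).2 ⟨s - 1, by omega, fun i hi => by
      rw [letter_ofSeq _ hi]
      rcases Nat.lt_or_ge i s with h | h
      · rw [if_neg (by omega), hv0 i h]
      · rw [if_pos (by omega), ← hv_s]
        congr 1
        omega⟩)
    obtain ⟨k, hk, hsh⟩ := (mem_inBall _ _ _).1 hmem
    have h1 := hsh 0 (by omega)
    rw [letter_ofSeq _ (by omega), if_neg (by omega), hu0 0 (by omega)] at h1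
    exact hce h1.symm

theorem exists_isIdCode (hd : 2 ≤ d) (ht : 1 ≤ t) (hn : 3 ≤ n) (hnt : 2 * t ≤ n) :
    ∃ S : Set (Vtx d n), IsIdCode d n t S ∧ S.ncard = d ^ (n - 1) * (d - 1) := by
  rcases ht.eq_or_lt with rfl | ht
  · obtain ⟨N, hN, h⟩ := exists_mem_isIdCode_one hd hn
    exact ⟨_, h, hN.ncard_compl (by omega)⟩
  · exact ⟨_, isIdCode_periodicTransversal_compl hd ht hnt,
      (isTransversal_periodicTransversal (by omega) hnt).ncard_compl (by omega)⟩

end Codes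

/-- for `2t ≤ n`, `B⃗(d,n)` is `t`-identifiable, and the minimum size of a
`t`-identifying code equals the directed metric dimension, both being `d^{n−1}(d−1)`. -/
theorem stmt11 (d n t : ℕ) (hd : 2 ≤ d) (ht : 1 ≤ t) (hn : 3 ≤ n) (hnt : 2 * t ≤ n) :
    (∃ S : Set (Vtx d n), IsIdCode d n t S) ∧
    sInf {k : ℕ | ∃ S : Set (Vtx d n), IsIdCode d n t S ∧ S.ncard = k} =
      d ^ (n - 1) * (d - 1) ∧
    metricDim d n = d ^ (n - 1) * (d - 1) := by
  have : NeZero n := ⟨by omega⟩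
  obtain ⟨S, hS, hcard⟩ := exists_isIdCode hd ht hn hnt
  refine ⟨⟨S, hS⟩, le_antisymm (Nat.sInf_le ⟨S, hS, hcard⟩) (le_csInf ⟨_, S, hS, rfl⟩ ?_),
    le_antisymm (Nat.sInf_le ⟨S, hS.isResolving, hcard⟩)
      (le_csInf ⟨_, S, hS.isResolving, rfl⟩ ?_)⟩
  · rintro _ ⟨T, hT, rfl⟩
    exact hT.isResolving.le_ncard (by omega)
  · rintro _ ⟨T, hT, rfl⟩
    exact hT.le_ncard (by omega)

end DeBruijnPaper
end
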